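/- Let κ : (0,∞) → ℝ be a Bernstein function that is not identically zero. Then there exist a constant b ≥ 0 and a locally integrable completely monotone (LICM) function F such that λ(t) = b·δ(t) + F(t) solves (κ∗λ)(t) = t, i.e., b·κ(t) + (κ∗F)(t) = t for all t > 0; moreover this solution is unique. -/

import Mathlib

open MeasureTheory Set Filter Topology

noncomputable section

/-- A real-valued function on `(0,∞)` is completely monotone (CM): infinitely
differentiable on `(0,∞)` with `(-1)^n f⁽ⁿ⁾(t) ≥ 0` for all `t > 0` and `n ∈ ℕ`. -/
def ScalarCM (f : ℝ → ℝ) : Prop :=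
  ContDiffOn ℝ (⊤ : ℕ∞) f (Set.Ioi 0) ∧
  ∀ n : ℕ, ∀ t ∈ Set.Ioi (0:ℝ), 0 ≤ (-1 : ℝ) ^ n * iteratedDeriv n f t

/-- Locally integrable completely monotone (LICM): CM and integrable over `(0,1]`. -/
def ScalarLICM (f : ℝ → ℝ) : Prop :=
  ScalarCM f ∧ MeasureTheory.IntegrableOn f (Set.Ioc 0 1)

/-- A Bernstein function: nonnegative, differentiable on `(0,∞)`, with CM derivative. -/
def ScalarBernstein (f : ℝ → ℝ) : Prop :=
  (∀ t ∈ Set.Ioi (0:ℝ), 0 ≤ f t) ∧ DifferentiableOn ℝ f (Set.Ioi 0) ∧ ScalarCM (deriv f)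

/-- `g` lists the alternating-sign derivatives `(-1)^n f⁽ⁿ⁾` of a completely monotone function
`f = g 0` on `(0,∞)`. -/
def CMFamily (g : ℕ → ℝ → ℝ) : Prop :=
  ∀ n, ∀ t > 0, 0 ≤ g n t ∧ HasDerivAt (g n) (-(g (n + 1) t)) t

theorem ScalarCM.contDiffOn_iteratedDeriv {f : ℝ → ℝ} (hf : ScalarCM f) (n : ℕ) :
    ContDiffOn ℝ (⊤ : ℕ∞) (iteratedDeriv n f) (Ioi 0) := by
  induction n with
  | zero => simpa using hf.1
  | succ n ih =>
    rw [iteratedDeriv_succ]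
    exact ((contDiffOn_infty_iff_deriv_of_isOpen isOpen_Ioi).1 ih).2

theorem ScalarCM.cmFamily {f : ℝ → ℝ} (hf : ScalarCM f) :
    CMFamily fun n t => (-1) ^ n * iteratedDeriv n f t := by
  intro n t ht
  refine ⟨hf.2 n t ht, ?_⟩
  have h : DifferentiableAt ℝ (iteratedDeriv n f) t :=
    ((hf.contDiffOn_iteratedDeriv n).differentiableOn (by simp)).differentiableAt
      (Ioi_mem_nhds ht)
  refine (h.hasDerivAt.const_mul ((-1 : ℝ) ^ n)).congr_deriv ?_
  simp only [iteratedDeriv_succ]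
  ring

namespace CMFamily

variable {g : ℕ → ℝ → ℝ}

theorem nonneg (hg : CMFamily g) (n : ℕ) {t : ℝ} (ht : 0 < t) : 0 ≤ g n t := (hg n t ht).1

theorem hasDerivAt (hg : CMFamily g) (n : ℕ) {t : ℝ} (ht : 0 < t) :
    HasDerivAt (g n) (-(g (n + 1) t)) t := (hg n t ht).2

theorem continuousOn (hg : CMFamily g) (n : ℕ) : ContinuousOn (g n) (Ioi 0) :=
  fun _ ht => (hg.hasDerivAt n ht).continuousAt.continuousWithinAt

theorem antitoneOn (hg : CMFamily g) (n : ℕ) : AntitoneOn (g n) (Ioi 0) := by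
  refine antitoneOn_of_deriv_nonpos (convex_Ioi 0) (hg.continuousOn n) ?_ ?_
  · rw [interior_Ioi]
    exact fun t ht => (hg.hasDerivAt n ht).differentiableAt.differentiableWithinAt
  · rw [interior_Ioi]
    intro t ht
    rw [(hg.hasDerivAt n ht).deriv]
    exact neg_nonpos.2 (hg.nonneg _ ht)

theorem iteratedDeriv_eq (hg : CMFamily g) (n : ℕ) :
    ∀ t > 0, iteratedDeriv n (g 0) t = (-1) ^ n * g n t := by
  induction n with
  | zero => simp
  | succ n ih =>
    intro t ht
    rw [iteratedDeriv_succ]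
    have : iteratedDeriv n (g 0) =ᶠ[𝓝 t] fun s => (-1) ^ n * g n s := by
      filter_upwards [Ioi_mem_nhds ht] with s hs using ih s hs
    rw [this.deriv_eq, ((hg.hasDerivAt n ht).const_mul _).deriv]
    ring

theorem scalarCM (hg : CMFamily g) : ScalarCM (g 0) := by
  have key : ∀ m n : ℕ, ContDiffOn ℝ m (g n) (Ioi 0) := by
    intro m
    induction m with
    | zero => intro n; simpa using hg.continuousOn n
    | succ m ih =>
      intro n
      rw [Nat.cast_succ, contDiffOn_succ_iff_deriv_of_isOpen isOpen_Ioi]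
      refine ⟨fun t ht => (hg.hasDerivAt n ht).differentiableAt.differentiableWithinAt,
        by simp, ?_⟩
      exact (ih (n + 1)).neg.congr fun t ht => (hg.hasDerivAt n ht).deriv
  refine ⟨contDiffOn_infty.2 fun m => key m 0, fun n t ht => ?_⟩
  rw [hg.iteratedDeriv_eq n t ht, ← mul_assoc, ← mul_pow]
  simpa using hg.nonneg n ht

theorem sub_comp_add (hg : CMFamily g) {h : ℝ} (hh : 0 ≤ h) :
    CMFamily fun n t => g n t - g n (t + h) := by
  intro n t ht
  have hth : 0 < t + h := by linarith
  refine ⟨sub_nonneg.2 (hg.antitoneOn n ht hth (by linarith)), ?_⟩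
  refine ((hg.hasDerivAt n ht).sub ((hg.hasDerivAt n hth).comp_add_const t h)).congr_deriv ?_
  ring

end CMFamily

/-- The shift operator `a ↦ (n ↦ a (n+1))` on real sequences. -/
def seqShift : Module.End ℝ (ℕ → ℝ) where
  toFun a n := a (n + 1)
  map_add' _ _ := rfl
  map_smul' _ _ := rfl

theorem seqShift_apply (a : ℕ → ℝ) (n : ℕ) : seqShift a n = a (n + 1) := rfl

theorem seqShift_pow_apply (k : ℕ) (a : ℕ → ℝ) (n : ℕ) : (seqShift ^ k) a n = a (n + k) := by
  induction k generalizing n with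
  | zero => simp
  | succ k ih =>
    rw [pow_succ', Module.End.mul_apply, seqShift_apply, ih]
    congr 1
    ring

/-- The difference operator `a ↦ (n ↦ a n - a (n+1))` on real sequences. -/
def seqDiff : Module.End ℝ (ℕ → ℝ) := 1 - seqShift

theorem seqDiff_apply (a : ℕ → ℝ) (n : ℕ) : seqDiff a n = a n - a (n + 1) := rfl

/-- Completely monotone sequences: all iterated differences are nonnegative. -/
def CMSeq (a : ℕ → ℝ) : Prop := ∀ m n, 0 ≤ (seqDiff ^ m) a n

theorem CMSeq.nonneg {a : ℕ → ℝ} (ha : CMSeq a) (n : ℕ) : 0 ≤ a n := by simpa using ha 0 n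

theorem CMSeq.antitone {a : ℕ → ℝ} (ha : CMSeq a) : Antitone a :=
  antitone_nat_of_succ_le fun n => by
    have := ha 1 n
    rw [pow_one, seqDiff_apply] at this
    linarith

theorem eq_sum_seqDiff (a : ℕ → ℝ) (M n : ℕ) :
    a n = ∑ i ∈ Finset.range (M + 1), (M.choose i : ℝ) * (seqDiff ^ (M - i)) a (n + i) := by
  have hc : Commute seqShift seqDiff := (Commute.one_right _).sub_right (Commute.refl _)
  have h1 : (1 : Module.End ℝ (ℕ → ℝ)) = (seqShift + seqDiff) ^ M := by
    rw [seqDiff, add_sub_cancel, one_pow]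
  have h2 : a n = ((1 : Module.End ℝ (ℕ → ℝ)) a) n := rfl
  rw [h2, h1, hc.add_pow, LinearMap.sum_apply, Finset.sum_apply]
  refine Finset.sum_congr rfl fun i _ => ?_
  rw [← (Nat.cast_commute (M.choose i) _).eq, Module.End.mul_apply, Module.End.mul_apply,
    ← nsmul_one, LinearMap.smul_apply, Module.End.one_apply, Pi.smul_apply, seqShift_pow_apply,
    nsmul_eq_mul]

/-- The weights of the Bernstein approximation, on `{0, 1/N, …, 1}`, of the Hausdorff moment
problem for `a`. -/
def momentWeight (a : ℕ → ℝ) (N j : ℕ) : ℝ := (N.choose j : ℝ) * (seqDiff ^ (N - j)) a j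

theorem CMSeq.momentWeight_nonneg {a : ℕ → ℝ} (ha : CMSeq a) (N j : ℕ) :
    0 ≤ momentWeight a N j := mul_nonneg (Nat.cast_nonneg _) (ha _ _)

theorem sum_momentWeight_mul_descFactorial (a : ℕ → ℝ) {N n : ℕ} (hn : n ≤ N) :
    ∑ j ∈ Finset.range (N + 1), momentWeight a N j * (j.descFactorial n : ℝ)
      = (N.descFactorial n : ℝ) * a n := by
  obtain ⟨M, rfl⟩ := Nat.exists_eq_add_of_le hn
  rw [eq_sum_seqDiff a M n, Finset.mul_sum, show n + M + 1 = n + (M + 1) by ring,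
    Finset.sum_range_add]
  have h0 : ∑ j ∈ Finset.range n, momentWeight a (n + M) j * (j.descFactorial n : ℝ) = 0 := by
    refine Finset.sum_eq_zero fun j hj => ?_
    rw [Nat.descFactorial_of_lt (Finset.mem_range.1 hj)]
    simp
  rw [h0, zero_add]
  refine Finset.sum_congr rfl fun i _ => ?_
  have h1 : (n + M).choose (n + i) * (n + i).choose n = (n + M).choose n * M.choose i := by
    rw [Nat.choose_mul (by omega)]
    simp
  have h2 : ((n + M).choose (n + i) : ℝ) * ((n + i).choose n : ℝ)
      = ((n + M).choose n : ℝ) * (M.choose i : ℝ) := by exact_mod_cast h1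
  rw [momentWeight, Nat.descFactorial_eq_factorial_mul_choose,
    Nat.descFactorial_eq_factorial_mul_choose, Nat.add_sub_add_left]
  push_cast
  linear_combination ((n.factorial : ℝ) * (seqDiff ^ (M - i)) a (n + i)) * h2

theorem tendsto_descFactorial_div_pow (n : ℕ) :
    Tendsto (fun N : ℕ => (N.descFactorial n : ℝ) / (N : ℝ) ^ n) atTop (𝓝 1) := by
  refine (Asymptotics.isEquivalent_iff_tendsto_one ?_).1 (isEquivalent_descFactorial n)
  filter_upwards [eventually_gt_atTop 0] with N hN
  positivity

theorem tendsto_sum_momentWeight_aux (a : ℕ → ℝ) (k n : ℕ) :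
    Tendsto (fun N : ℕ => (∑ j ∈ Finset.range (N + 1),
      momentWeight a N j * ((j.descFactorial n : ℝ) * (j : ℝ) ^ k)) / (N : ℝ) ^ (n + k))
      atTop (𝓝 (a (n + k))) := by
  induction k generalizing n with
  | zero =>
    have h := (tendsto_descFactorial_div_pow n).mul_const (a n)
    rw [one_mul] at h
    refine h.congr' ?_
    filter_upwards [eventually_ge_atTop n] with N hN
    simp only [pow_zero, mul_one, add_zero]
    rw [sum_momentWeight_mul_descFactorial a hN]
    ring
  | succ k ih =>
    have h1 := ih (n + 1)
    have h2 := (ih n).mul (tendsto_const_div_atTop_nhds_zero_nat (n : ℝ))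
    have h := h1.add h2
    rw [mul_zero, add_zero, show n + 1 + k = n + (k + 1) by ring] at h
    refine h.congr' ?_
    filter_upwards [eventually_gt_atTop 0] with N hN
    have hN' : (N : ℝ) ≠ 0 := by positivity
    rw [div_mul_div_comm, ← pow_succ, add_assoc n k 1, ← add_div, Finset.sum_mul,
      ← Finset.sum_add_distrib]
    congr 1
    refine Finset.sum_congr rfl fun j _ => ?_
    rw [Nat.descFactorial_succ]
    rcases lt_or_ge j n with hj | hj
    · simp [Nat.descFactorial_of_lt hj]
    · push_cast [hj]
      ring

theorem tendsto_sum_momentWeight (a : ℕ → ℝ) (k : ℕ) :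
    Tendsto (fun N : ℕ => ∑ j ∈ Finset.range (N + 1), momentWeight a N j * ((j : ℝ) / N) ^ k)
      atTop (𝓝 (a k)) := by
  have h := tendsto_sum_momentWeight_aux a k 0
  rw [zero_add] at h
  refine h.congr fun N => ?_
  rw [Finset.sum_div]
  refine Finset.sum_congr rfl fun j _ => ?_
  rw [div_pow]
  simp
  ring

open Polynomial in
/-- The moment functional `X^n ↦ a n`. -/
def momentFunctional (a : ℕ → ℝ) : ℝ[X] →ₗ[ℝ] ℝ :=
  Polynomial.lsum fun n => LinearMap.toSpanSingleton ℝ ℝ (a n)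

section Moment

open Polynomial

theorem momentFunctional_apply (a : ℕ → ℝ) (p : ℝ[X]) :
    momentFunctional a p = p.sum fun n c => c * a n := by
  simp [momentFunctional, Polynomial.lsum_apply]

theorem momentFunctional_X_pow (a : ℕ → ℝ) (n : ℕ) : momentFunctional a (X ^ n) = a n := by
  rw [momentFunctional_apply, ← Polynomial.monomial_one_right_eq_X_pow,
    Polynomial.sum_monomial_index] <;> simp

theorem momentFunctional_C_mul (a : ℕ → ℝ) (c : ℝ) (p : ℝ[X]) :
    momentFunctional a (C c * p) = c * momentFunctional a p := by
  rw [← Polynomial.smul_eq_C_mul, map_smul, smul_eq_mul]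

theorem momentFunctional_C (a : ℕ → ℝ) (c : ℝ) : momentFunctional a (C c) = c * a 0 := by
  rw [← mul_one (C c), momentFunctional_C_mul, ← pow_zero X, momentFunctional_X_pow]

theorem CMSeq.momentFunctional_nonneg {a : ℕ → ℝ} (ha : CMSeq a) {p : ℝ[X]}
    (hp : ∀ x ∈ Icc (0 : ℝ) 1, 0 ≤ p.eval x) : 0 ≤ momentFunctional a p := by
  have h : Tendsto (fun N : ℕ => ∑ j ∈ Finset.range (N + 1),
      momentWeight a N j * p.eval ((j : ℝ) / N)) atTop (𝓝 (momentFunctional a p)) := by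
    rw [momentFunctional_apply, Polynomial.sum_def]
    have := tendsto_finsetSum p.support fun n _ =>
      (tendsto_sum_momentWeight a n).const_mul (p.coeff n)
    refine this.congr fun N => ?_
    simp_rw [Polynomial.eval_eq_sum, Polynomial.sum_def, Finset.mul_sum]
    rw [Finset.sum_comm]
    exact Finset.sum_congr rfl fun _ _ => Finset.sum_congr rfl fun _ _ => by ring
  refine ge_of_tendsto' h fun N => Finset.sum_nonneg fun j hj =>
    mul_nonneg (ha.momentWeight_nonneg N j) (hp _ ⟨by positivity, ?_⟩)
  have : (j : ℝ) ≤ N := by exact_mod_cast Nat.lt_succ_iff.1 (Finset.mem_range.1 hj)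
  exact div_le_one_of_le₀ this (Nat.cast_nonneg N)

/-- If `T` is symmetric with `0 ≤ T ≤ 1` for a positive semidefinite form, then so is
`T^n (1-T)^m`. -/
theorem form_pow_mul_pow_nonneg {V : Type*} [AddCommGroup V] [Module ℝ V]
    (B : V →ₗ[ℝ] V →ₗ[ℝ] ℝ) (T : Module.End ℝ V)
    (hT : ∀ f g, B (T f) g = B f (T g)) (h0 : ∀ f, 0 ≤ B f f) (h1 : ∀ f, 0 ≤ B f (T f))
    (h2 : ∀ f, B f (T f) ≤ B f f) (n m : ℕ) (v : V) :
    0 ≤ B v ((T ^ n * (1 - T) ^ m) v) := by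
  have adj : ∀ (q : ℝ[X]) f g, B (aeval T q f) g = B f (aeval T q g) := by
    intro q
    induction q using Polynomial.induction_on' with
    | add p q hp hq => intro f g; simp [hp, hq]
    | monomial n c =>
      induction n with
      | zero => intro f g; simp [Module.algebraMap_end_apply]
      | succ n ih =>
        intro f g
        have hc := congrArg (aeval T) (mul_comm (X : ℝ[X]) (monomial n c))
        rw [map_mul, map_mul, aeval_X] at hc
        rw [← Polynomial.monomial_mul_X, map_mul, Module.End.mul_apply, aeval_X, ih, hT,
          ← Module.End.mul_apply, hc]
  have sq : ∀ (r s : ℝ[X]), (∀ f, 0 ≤ B f (aeval T s f)) → ∀ f, 0 ≤ B f (aeval T (r * r * s) f) := by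
    intro r s hs f
    rw [mul_assoc, mul_comm r s, map_mul, map_mul, Module.End.mul_apply, ← adj,
      Module.End.mul_apply]
    exact hs _
  have hX : ∀ f, 0 ≤ B f (aeval T (X : ℝ[X]) f) := by simpa using h1
  have hY : ∀ f, 0 ≤ B f (aeval T (1 - X : ℝ[X]) f) := by simpa using h2
  have hXY : ∀ f, 0 ≤ B f (aeval T (X * (1 - X) : ℝ[X]) f) := by
    intro f
    rw [show (X * (1 - X) : ℝ[X]) = X * X * (1 - X) + (1 - X) * (1 - X) * X by ring, map_add,
      LinearMap.add_apply, map_add]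
    exact add_nonneg (sq X _ hY f) (sq (1 - X) _ hX f)
  have e : T ^ n * (1 - T) ^ m = aeval T (X ^ n * (1 - X) ^ m : ℝ[X]) := by simp
  rw [e]
  rcases Nat.even_or_odd' n with ⟨p, rfl | rfl⟩ <;> rcases Nat.even_or_odd' m with ⟨q, rfl | rfl⟩
  · rw [show (X ^ (2 * p) * (1 - X) ^ (2 * q) : ℝ[X])
      = (X ^ p * (1 - X) ^ q) * (X ^ p * (1 - X) ^ q) * 1 by ring]
    exact sq _ _ (by simpa using h0) v
  · rw [show (X ^ (2 * p) * (1 - X) ^ (2 * q + 1) : ℝ[X])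
      = (X ^ p * (1 - X) ^ q) * (X ^ p * (1 - X) ^ q) * (1 - X) by ring]
    exact sq _ _ hY v
  · rw [show (X ^ (2 * p + 1) * (1 - X) ^ (2 * q) : ℝ[X])
      = (X ^ p * (1 - X) ^ q) * (X ^ p * (1 - X) ^ q) * X by ring]
    exact sq _ _ hX v
  · rw [show (X ^ (2 * p + 1) * (1 - X) ^ (2 * q + 1) : ℝ[X])
      = (X ^ p * (1 - X) ^ q) * (X ^ p * (1 - X) ^ q) * (X * (1 - X)) by ring]
    exact sq _ _ hXY v

/-- Multiplication by `X` compressed to the kernel of the moment functional. -/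
def momentShift (a : ℕ → ℝ) : Module.End ℝ ℝ[X] :=
  LinearMap.mulLeft ℝ X -
    (LinearMap.toSpanSingleton ℝ ℝ[X] 1).comp
      ((a 0)⁻¹ • (momentFunctional a).comp (LinearMap.mulLeft ℝ X))

theorem momentShift_apply (a : ℕ → ℝ) (p : ℝ[X]) :
    momentShift a p = X * p - C (momentFunctional a (X * p) / a 0) := by
  simp [momentShift, Polynomial.smul_eq_C_mul, div_eq_inv_mul]

/-- The form `(p, q) ↦ L (X p q)` of a moment functional `L`. -/
def momentForm (a : ℕ → ℝ) : ℝ[X] →ₗ[ℝ] ℝ[X] →ₗ[ℝ] ℝ :=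
  (LinearMap.mul ℝ ℝ[X]).compr₂ ((momentFunctional a).comp (LinearMap.mulLeft ℝ X))

theorem momentForm_apply (a : ℕ → ℝ) (p q : ℝ[X]) :
    momentForm a p q = momentFunctional a (X * (p * q)) := by
  simp [momentForm]

theorem momentForm_momentShift (a : ℕ → ℝ) (p q : ℝ[X]) :
    momentForm a p (momentShift a q) = momentFunctional a ((X * p) * (X * q))
      - momentFunctional a (X * p) * momentFunctional a (X * q) / a 0 := by
  rw [momentForm_apply, momentShift_apply,
    show X * (p * (X * q - C (momentFunctional a (X * q) / a 0)))
      = (X * p) * (X * q) - C (momentFunctional a (X * q) / a 0) * (X * p) by ring,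
    map_sub, momentFunctional_C_mul]
  ring

theorem CMSeq.sq_momentFunctional_le {a : ℕ → ℝ} (ha : CMSeq a) (h0 : 0 < a 0) (p : ℝ[X]) :
    momentFunctional a p * momentFunctional a p / a 0 ≤ momentFunctional a (p * p) := by
  set c := momentFunctional a p / a 0 with hc
  have h : 0 ≤ momentFunctional a ((p - C c) * (p - C c)) :=
    ha.momentFunctional_nonneg fun x _ => by rw [eval_mul]; exact mul_self_nonneg _
  rw [show (p - C c) * (p - C c) = p * p - C (2 * c) * p + C (c * c) by
      simp only [C_mul, map_ofNat]; ring, map_add, map_sub, momentFunctional_C_mul,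
    momentFunctional_C] at h
  have e : momentFunctional a p = c * a 0 := by rw [hc]; field_simp
  have e2 : momentFunctional a p * momentFunctional a p / a 0 = c * c * a 0 := by
    rw [e]; field_simp
  rw [e2]
  rw [e] at h
  linarith

theorem CMSeq.momentForm_pow_nonneg {a : ℕ → ℝ} (ha : CMSeq a) (h0 : 0 < a 0) (n m : ℕ)
    (p : ℝ[X]) : 0 ≤ momentForm a p ((momentShift a ^ n * (1 - momentShift a) ^ m) p) := by
  refine form_pow_mul_pow_nonneg _ _ ?_ ?_ ?_ ?_ n m p
  · intro f g
    have : momentForm a (momentShift a f) g = momentForm a g (momentShift a f) := by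
      rw [momentForm_apply, momentForm_apply, mul_comm (momentShift a f)]
    rw [this, momentForm_momentShift, momentForm_momentShift, mul_comm (X * f),
      mul_comm (momentFunctional a (X * f))]
  · intro f
    rw [momentForm_apply]
    refine ha.momentFunctional_nonneg fun x hx => ?_
    rw [eval_mul, eval_mul, eval_X]
    exact mul_nonneg hx.1 (mul_self_nonneg _)
  · intro f
    rw [momentForm_momentShift]
    exact sub_nonneg.2 (ha.sq_momentFunctional_le h0 _)
  · intro f
    rw [momentForm_momentShift]
    have h1 : 0 ≤ momentFunctional a (X * (f * f) - (X * f) * (X * f)) := by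
      refine ha.momentFunctional_nonneg fun x hx => ?_
      simp only [eval_sub, eval_mul, eval_X]
      have := mul_nonneg (mul_nonneg hx.1 (sub_nonneg.2 hx.2)) (mul_self_nonneg (eval x f))
      linarith
    rw [map_sub, ← momentForm_apply] at h1
    have h2 : 0 ≤ momentFunctional a (X * f) * momentFunctional a (X * f) / a 0 :=
      div_nonneg (mul_self_nonneg _) h0.le
    linarith

/-- The coefficients of the renewal equation of `a`. -/
def renewalSeq (a : ℕ → ℝ) (n : ℕ) : ℝ :=
  momentFunctional a (X * (momentShift a ^ n) 1) / a 0

theorem CMSeq.cmSeq_renewalSeq {a : ℕ → ℝ} (ha : CMSeq a) (h0 : 0 < a 0) :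
    CMSeq (renewalSeq a) := by
  have key : ∀ m n, (seqDiff ^ m) (renewalSeq a) n
      = momentForm a 1 ((momentShift a ^ n * (1 - momentShift a) ^ m) 1) / a 0 := by
    intro m
    induction m with
    | zero => intro n; simp [momentForm_apply, renewalSeq]
    | succ m ih =>
      intro n
      rw [pow_succ', Module.End.mul_apply, seqDiff_apply, ih, ih, ← sub_div, ← map_sub,
        ← LinearMap.sub_apply, pow_succ, pow_succ', mul_assoc, ← mul_sub, ← one_sub_mul]
  intro m n
  rw [key]
  exact div_nonneg (ha.momentForm_pow_nonneg h0 n m 1) h0.le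

theorem renewalSeq_spec {a : ℕ → ℝ} (h0 : a 0 ≠ 0) (n : ℕ) :
    a (n + 1) = ∑ j ∈ Finset.range (n + 1), a (n - j) * renewalSeq a j := by
  have hX : ∀ n, X * (momentShift a ^ n) 1 = (momentShift a ^ (n + 1)) 1 + C (renewalSeq a n) := by
    intro n
    rw [pow_succ', Module.End.mul_apply, momentShift_apply, renewalSeq, sub_add_cancel]
  have hpow : ∀ n, (X : ℝ[X]) ^ n = (momentShift a ^ n) 1
      + ∑ j ∈ Finset.range n, C (renewalSeq a j) * X ^ (n - 1 - j) := by
    intro n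
    induction n with
    | zero => simp
    | succ n ih =>
      rw [pow_succ', ih, mul_add, hX, Finset.sum_range_succ, Finset.mul_sum, Nat.add_sub_cancel,
        Nat.sub_self, pow_zero, mul_one]
      have : ∀ j ∈ Finset.range n, X * (C (renewalSeq a j) * X ^ (n - 1 - j))
          = C (renewalSeq a j) * X ^ (n - j) := by
        intro j hj
        have hj := Finset.mem_range.1 hj
        rw [show n - j = n - 1 - j + 1 by omega, pow_succ]
        ring
      rw [Finset.sum_congr rfl this]
      ring
  have h := congrArg (momentFunctional a) (hpow (n + 1))
  have hz : momentFunctional a ((momentShift a ^ (n + 1)) 1) = 0 := by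
    rw [pow_succ', Module.End.mul_apply, momentShift_apply, map_sub, momentFunctional_C,
      div_mul_cancel₀ _ h0, sub_self]
  rw [momentFunctional_X_pow, map_add, hz, zero_add, map_sum] at h
  rw [h]
  refine Finset.sum_congr rfl fun j _ => ?_
  rw [momentFunctional_C_mul, momentFunctional_X_pow, mul_comm, Nat.add_sub_cancel]

/-- A completely monotone sequence has a completely monotone resolvent. -/
theorem CMSeq.exists_resolvent {a : ℕ → ℝ} (ha : CMSeq a) (h0 : 0 < a 0) :
    ∃ B : ℕ → ℝ, CMSeq B ∧ ∀ n, ∑ j ∈ Finset.range (n + 1), a (n - j) * B j = 1 := by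
  set B : ℕ → ℝ := fun n => (1 - ∑ j ∈ Finset.range n, renewalSeq a j) / a 0 with hB
  have hB0 : B 0 = 1 / a 0 := by simp [hB]
  have hD : seqDiff B = (a 0)⁻¹ • renewalSeq a := by
    funext n
    rw [seqDiff_apply, Pi.smul_apply, smul_eq_mul, hB]
    simp only [Finset.sum_range_succ]
    ring
  have hBs : ∀ n, B (n + 1) = B n - (a 0)⁻¹ * renewalSeq a n := by
    intro n
    have := congrFun hD n
    rw [seqDiff_apply, Pi.smul_apply, smul_eq_mul] at this
    linarith
  have hconv : ∀ n, ∑ j ∈ Finset.range (n + 1), a (n - j) * B j = 1 := by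
    intro n
    induction n with
    | zero => simp [hB0, h0.ne']
    | succ n ih =>
      rw [Finset.sum_range_succ', hB0]
      have : ∀ j ∈ Finset.range (n + 1), a (n + 1 - (j + 1)) * B (j + 1)
          = a (n - j) * B j - (a 0)⁻¹ * (a (n - j) * renewalSeq a j) := by
        intro j _
        rw [hBs, Nat.add_sub_add_right]
        ring
      rw [Finset.sum_congr rfl this, Finset.sum_sub_distrib, ih, ← Finset.mul_sum,
        ← renewalSeq_spec h0.ne', Nat.sub_zero]
      ring
  have hnn : ∀ n, 0 ≤ B n := by
    intro n
    induction n using Nat.strong_induction_on with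
    | _ n ih =>
      cases n with
      | zero => rw [hB0]; positivity
      | succ n =>
        have h1 := hconv (n + 1)
        rw [Finset.sum_range_succ, ← hconv n, Nat.sub_self] at h1
        have h2 : ∑ j ∈ Finset.range (n + 1), a (n + 1 - j) * B j
            ≤ ∑ j ∈ Finset.range (n + 1), a (n - j) * B j := by
          refine Finset.sum_le_sum fun j hj => ?_
          exact mul_le_mul_of_nonneg_right (ha.antitone (by omega)) (ih j (Finset.mem_range.1 hj))
        exact nonneg_of_mul_nonneg_right (by linarith) h0
  refine ⟨B, fun m n => ?_, hconv⟩
  cases m with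
  | zero => simpa using hnn n
  | succ m =>
    rw [pow_succ, Module.End.mul_apply, hD, map_smul, Pi.smul_apply, smul_eq_mul]
    exact mul_nonneg (inv_nonneg.2 h0.le) (ha.cmSeq_renewalSeq h0 m n)

end Moment

theorem CMSeq.add {a b : ℕ → ℝ} (ha : CMSeq a) (hb : CMSeq b) : CMSeq (a + b) := fun m n => by
  rw [map_add]
  exact add_nonneg (ha m n) (hb m n)

theorem cmSeq_single {c : ℝ} (hc : 0 ≤ c) : CMSeq (Pi.single 0 c) := by
  have key : ∀ m, (seqDiff ^ m) (Pi.single 0 c : ℕ → ℝ) = Pi.single 0 c := by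
    intro m
    induction m with
    | zero => rfl
    | succ m ih =>
      rw [pow_succ, Module.End.mul_apply]
      convert ih using 2
      funext n
      simp [seqDiff_apply]
  intro m n
  rw [key]
  cases n <;> simp [hc]

theorem CMFamily.cmSeq {g : ℕ → ℝ → ℝ} (hg : CMFamily g) {h : ℝ} (hh : 0 < h) :
    CMSeq fun n : ℕ => g 0 ((n + 1) * h) := by
  intro m
  induction m generalizing g with
  | zero => exact fun n => hg.nonneg 0 (by positivity)
  | succ m ih =>
    intro n
    rw [pow_succ, Module.End.mul_apply]
    convert ih (hg.sub_comp_add hh.le) n using 3 with k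
    rw [seqDiff_apply]
    push_cast
    ring_nf

section Kernel

variable {κ : ℝ → ℝ} {g : ℕ → ℝ → ℝ}

theorem CMFamily.increment (hg : CMFamily g) (hκ : ∀ t > 0, HasDerivAt κ (g 0 t) t)
    (hmono : MonotoneOn κ (Ioi 0)) {h : ℝ} (hh : 0 < h) :
    CMFamily fun n t => Nat.casesOn n (κ (t + h) - κ t) fun k => g k t - g k (t + h) := by
  intro n t ht
  cases n with
  | zero =>
    have hth : 0 < t + h := by linarith
    refine ⟨sub_nonneg.2 (hmono ht hth (by linarith)), ?_⟩
    refine (((hκ _ hth).comp_add_const t h).sub (hκ t ht)).congr_deriv ?_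
    dsimp only
    ring
  | succ n => exact hg.sub_comp_add hh.le n t ht

/-- The discretized equation `κ ∗ λ = t` has a completely monotone solution. -/
theorem CMFamily.exists_discrete_resolvent (hg : CMFamily g)
    (hκ : ∀ t > 0, HasDerivAt κ (g 0 t) t) (hmono : MonotoneOn κ (Ioi 0))
    (hpos : ∀ t > 0, 0 < κ t) {h : ℝ} (hh : 0 < h) :
    ∃ B : ℕ → ℝ, CMSeq B ∧
      ∀ n : ℕ, ∑ j ∈ Finset.range (n + 1), κ (((n - j : ℕ) + 2) * h) * B j = n + 1 := by
  set a : ℕ → ℝ := (fun n : ℕ => κ ((n + 1) * h + h) - κ ((n + 1) * h)) + Pi.single 0 (κ h) with ha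
  have haCM : CMSeq a :=
    ((hg.increment hκ hmono hh).cmSeq hh).add (cmSeq_single (hpos h hh).le)
  have ha0 : a 0 = κ (2 * h) := by simp [ha, two_mul]
  have has : ∀ n, a (n + 1) = κ (((n + 1 : ℕ) + 2) * h) - κ ((n + 2) * h) := by
    intro n
    simp only [ha, Pi.add_apply, Pi.single_apply, Nat.succ_ne_zero, if_false, add_zero]
    push_cast
    ring_nf
  obtain ⟨B, hB, hconv⟩ := haCM.exists_resolvent (by rw [ha0]; exact hpos _ (by positivity))
  refine ⟨B, hB, fun n => ?_⟩
  induction n with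
  | zero => simpa [ha0] using hconv 0
  | succ n ih =>
    have h1 := hconv (n + 1)
    rw [Finset.sum_range_succ] at h1 ⊢
    have : ∀ j ∈ Finset.range (n + 1), κ (((n + 1 - j : ℕ) + 2) * h) * B j
        = κ (((n - j : ℕ) + 2) * h) * B j + a (n + 1 - j) * B j := by
      intro j hj
      have hj := Finset.mem_range.1 hj
      rw [show n + 1 - j = n - j + 1 by omega, has]
      ring
    rw [Finset.sum_congr rfl this, Finset.sum_add_distrib, ih]
    rw [Nat.sub_self, ha0] at h1
    push_cast
    rw [Nat.sub_self, Nat.cast_zero, zero_add]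
    linarith

end Kernel

/-- A completely monotone sequence is interpolated, approximately, by a completely monotone
function. -/
theorem CMSeq.exists_cmFamily_approx {B : ℕ → ℝ} (hB : CMSeq B) {M : ℕ} (hM : 0 < M) (K : ℕ)
    {ε : ℝ} (hε : 0 < ε) :
    ∃ g, CMFamily g ∧ ∀ n : ℕ, 1 ≤ n → n ≤ K → |g 0 (n / M) - B n| ≤ ε := by
  have hev : ∀ᶠ N : ℕ in atTop, ∀ n ∈ Finset.range (K + 1),
      |∑ j ∈ Finset.range (N + 1), momentWeight B N j * ((j : ℝ) / N) ^ n - B n| < ε := by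
    refine (Finset.range (K + 1)).eventually_all.2 fun n _ => ?_
    exact (Metric.tendsto_nhds.1 (tendsto_sum_momentWeight B n) ε hε)
  obtain ⟨N, hN, hN0⟩ := (hev.and (eventually_gt_atTop 0)).exists
  set μ : ℕ → ℝ := fun j => -(M * Real.log ((j + 1 : ℕ) / N)) with hμ
  refine ⟨fun k t => ∑ j ∈ Finset.range N, momentWeight B N (j + 1) * (μ j ^ k
    * Real.exp (-(μ j * t))), fun k t ht => ⟨?_, ?_⟩, fun n hn1 hnK => ?_⟩
  · refine Finset.sum_nonneg fun j hj => mul_nonneg (hB.momentWeight_nonneg _ _) ?_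
    have : μ j ≥ 0 := by
      have h1 : ((j + 1 : ℕ) : ℝ) ≤ N := by exact_mod_cast Finset.mem_range.1 hj
      have h2 := Real.log_nonpos (by positivity) (div_le_one_of_le₀ h1 (Nat.cast_nonneg N))
      have := mul_nonpos_of_nonneg_of_nonpos (Nat.cast_nonneg (α := ℝ) M) h2
      rw [hμ]
      dsimp only
      linarith
    positivity
  · rw [← Finset.sum_neg_distrib]
    refine HasDerivAt.fun_sum fun j _ => ?_
    have h1 : HasDerivAt (fun t => Real.exp (-(μ j * t))) (Real.exp (-(μ j * t)) * -(μ j * 1)) t :=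
      (((hasDerivAt_id t).const_mul (μ j)).neg).exp
    refine ((h1.const_mul (μ j ^ k)).const_mul (momentWeight B N (j + 1))).congr_deriv ?_
    ring
  · have h := hN n (Finset.mem_range.2 (by omega))
    rw [Finset.sum_range_succ'] at h
    have h0 : momentWeight B N 0 * (((0 : ℕ) : ℝ) / N) ^ n = 0 := by
      simp [show n ≠ 0 by omega]
    rw [h0, add_zero] at h
    refine le_of_eq_of_le ?_ h.le
    congr 2
    refine Finset.sum_congr rfl fun j _ => ?_
    congr 1
    have hx : (0 : ℝ) < (j + 1 : ℕ) / N := by positivity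
    have hM' : (M : ℝ) ≠ 0 := by positivity
    have e : -(μ j * (n / M)) = n * Real.log ((j + 1 : ℕ) / N) := by
      rw [hμ]
      field_simp
    rw [pow_zero, one_mul, e, Real.exp_nat_mul, Real.exp_log hx]

namespace CMFamily

variable {g : ℕ → ℝ → ℝ}

theorem abs_sub_le (hg : CMFamily g) (n : ℕ) {r s t : ℝ} (hr : 0 < r) (hs : r ≤ s) (ht : r ≤ t) :
    |g n t - g n s| ≤ g (n + 1) r * |t - s| := by
  refine (convex_Ici r).norm_image_sub_le_of_norm_hasDerivWithin_le
    (fun u hu => (hg.hasDerivAt n (hr.trans_le hu)).hasDerivWithinAt) (fun u hu => ?_) hs ht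
  rw [norm_neg, Real.norm_of_nonneg (hg.nonneg _ (hr.trans_le hu))]
  exact hg.antitoneOn _ hr (hr.trans_le hu) hu

theorem taylor_le (hg : CMFamily g) (n : ℕ) {r s t : ℝ} (hr : 0 < r) (hs : r ≤ s) (ht : r ≤ t) :
    |g n t - g n s + g (n + 1) s * (t - s)| ≤ g (n + 2) r * (t - s) ^ 2 := by
  have hsub : ∀ u ∈ uIcc s t, r ≤ u := fun u hu => (le_min hs ht).trans hu.1
  have h := (convex_uIcc s t).norm_image_sub_le_of_norm_hasDerivWithin_le
    (f := fun u => g n u + g (n + 1) s * u) (f' := fun u => -(g (n + 1) u) + g (n + 1) s * 1)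
    (C := g (n + 2) r * |t - s|)
    (fun u hu => ((hg.hasDerivAt n (hr.trans_le (hsub u hu))).add
      ((hasDerivAt_id u).const_mul _)).hasDerivWithinAt) (fun u hu => ?_)
    left_mem_uIcc right_mem_uIcc
  · rw [Real.norm_eq_abs, Real.norm_eq_abs, mul_assoc, abs_mul_abs_self, ← pow_two] at h
    convert h using 2
    ring
  · rw [mul_one, neg_add_eq_sub, Real.norm_eq_abs, abs_sub_comm]
    refine (hg.abs_sub_le (n + 1) hr hs (hsub u hu)).trans ?_
    exact mul_le_mul_of_nonneg_left (abs_sub_left_of_mem_uIcc hu) (hg.nonneg _ hr)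

theorem succ_le (hg : CMFamily g) (n : ℕ) {t : ℝ} (ht : 0 < t) :
    g (n + 1) t ≤ g n (t / 2) / (t / 2) := by
  obtain ⟨c, hc, he⟩ := exists_hasDerivAt_eq_slope (g n) (fun u => -(g (n + 1) u))
    (show t / 2 < t by linarith)
    ((hg.continuousOn n).mono fun u hu => lt_of_lt_of_le (by linarith) hu.1)
    (fun u hu => hg.hasDerivAt n (lt_trans (by linarith) hu.1))
  have hc0 : 0 < c := lt_trans (by linarith) hc.1
  have h1 := hg.antitoneOn (n + 1) hc0 ht hc.2.le
  refine h1.trans ?_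
  have h2 : g (n + 1) c = (g n (t / 2) - g n t) / (t / 2) := by
    rw [eq_div_iff (by linarith)] at he ⊢
    linarith
  rw [h2]
  exact div_le_div_of_nonneg_right (by linarith [hg.nonneg n ht]) (by linarith)

end CMFamily

theorem cauchySeq_of_forall_exists_near {u : ℕ → ℝ}
    (h : ∀ ε > 0, ∃ v : ℕ → ℝ, CauchySeq v ∧ ∀ m, |u m - v m| ≤ ε) : CauchySeq u := by
  refine Metric.cauchySeq_iff.2 fun ε hε => ?_
  obtain ⟨v, hv, huv⟩ := h (ε / 4) (by linarith)
  obtain ⟨N, hN⟩ := Metric.cauchySeq_iff.1 hv (ε / 4) (by linarith)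
  refine ⟨N, fun m hm n hn => ?_⟩
  have h1 := abs_le.1 (huv m)
  have h2 := abs_le.1 (huv n)
  have h3 := abs_lt.1 (hN m hm n hn)
  rw [Real.dist_eq, abs_lt]
  constructor <;> linarith [h1.1, h1.2, h2.1, h2.2, h3.1, h3.2]

theorem hasDerivAt_of_abs_sub_le_sq {f : ℝ → ℝ} {f' x C : ℝ}
    (h : ∀ᶠ y in 𝓝 x, |f y - f x - f' * (y - x)| ≤ C * (y - x) ^ 2) : HasDerivAt f f' x := by
  rw [hasDerivAt_iff_isLittleO]
  have h1 : (fun y => f y - f x - (y - x) • f') =O[𝓝 x] fun y => (y - x) ^ 2 := by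
    refine Asymptotics.IsBigO.of_bound C (h.mono fun y hy => ?_)
    rw [smul_eq_mul, mul_comm, Real.norm_eq_abs, Real.norm_of_nonneg (sq_nonneg _)]
    exact hy
  refine h1.trans_isLittleO ?_
  have h2 : Tendsto (fun y => y - x) (𝓝 x) (𝓝 0) := by
    have : Tendsto (fun y => y - x) (𝓝 x) (𝓝 (x - x)) := (continuous_id.sub continuous_const).tendsto x
    rwa [sub_self] at this
  have h3 := (Asymptotics.isLittleO_pow_id (𝕜 := ℝ) (one_lt_two)).comp_tendsto h2
  exact h3

/-- Helly selection for completely monotone functions. -/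
theorem exists_subseq_tendsto_cmFamily {g : ℕ → ℕ → ℝ → ℝ} (hg : ∀ m, CMFamily (g m))
    (hb : ∀ t > 0, ∃ C, ∀ m, g m 0 t ≤ C) :
    ∃ φ : ℕ → ℕ, StrictMono φ ∧ ∃ G, CMFamily G ∧
      ∀ t > 0, Tendsto (fun m => g (φ m) 0 t) atTop (𝓝 (G 0 t)) := by
  have hb' : ∀ k, ∀ t > 0, ∃ C, ∀ m, g m k t ≤ C := by
    intro k
    induction k with
    | zero => exact hb
    | succ k ih =>
      intro t ht
      obtain ⟨C, hC⟩ := ih (t / 2) (by linarith)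
      exact ⟨C / (t / 2), fun m => ((hg m).succ_le k ht).trans
        (div_le_div_of_nonneg_right (hC m) (by linarith))⟩
  choose! C hC using hb'
  let x : ℕ → (ℕ × {q : ℚ // 0 < q}) → ℝ := fun m i => g m i.1 (i.2 : ℚ)
  have hqpos : ∀ q : {q : ℚ // 0 < q}, (0 : ℝ) < (q : ℚ) := fun q => by exact_mod_cast q.2
  have hcomp : IsCompact (Set.univ.pi fun i : ℕ × {q : ℚ // 0 < q} =>
      Icc (0 : ℝ) (C i.1 (i.2 : ℚ))) := isCompact_univ_pi fun _ => isCompact_Icc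
  obtain ⟨y, -, φ, hφ, hlim⟩ := hcomp.tendsto_subseq (x := x)
    fun m i _ => ⟨(hg m).nonneg _ (hqpos _), hC _ _ (hqpos _) m⟩
  have hlimq : ∀ k (q : {q : ℚ // 0 < q}), CauchySeq fun m => g (φ m) k (q : ℚ) :=
    fun k q => (tendsto_pi_nhds.1 hlim (k, q)).cauchySeq
  have hlimt : ∀ k, ∀ t > 0, ∃ L, Tendsto (fun m => g (φ m) k t) atTop (𝓝 L) := by
    intro k t ht
    refine cauchySeq_tendsto_of_complete (cauchySeq_of_forall_exists_near fun ε hε => ?_)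
    have hK0 : 0 ≤ C (k + 1) (t / 2) :=
      ((hg 0).nonneg _ (by linarith)).trans (hC (k + 1) (t / 2) (by linarith) 0)
    obtain ⟨q, hq1, hq2⟩ := exists_rat_btwn
      (show t < t + ε / (C (k + 1) (t / 2) + 1) by linarith [div_pos hε (show 0 < C (k + 1) (t / 2) + 1 by linarith)])
    have hq0 : 0 < q := by exact_mod_cast ht.trans hq1
    refine ⟨_, hlimq k ⟨q, hq0⟩, fun m => ?_⟩
    refine ((hg (φ m)).abs_sub_le k (r := t / 2) (by linarith) (by simp only; linarith)
      (by linarith)).trans ?_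
    have h1 := hC (k + 1) (t / 2) (by linarith) (φ m)
    have h2 : |t - q| ≤ ε / (C (k + 1) (t / 2) + 1) := by
      rw [abs_sub_comm, abs_of_pos (by linarith)]
      linarith
    calc _ ≤ (C (k + 1) (t / 2) + 1) * (ε / (C (k + 1) (t / 2) + 1)) := by
            refine mul_le_mul (by linarith) h2 (abs_nonneg _) (by linarith)
      _ = ε := by field_simp
  choose! G hG using hlimt
  refine ⟨φ, hφ, G, fun k s hs => ⟨ge_of_tendsto' (hG k s hs) fun m => (hg _).nonneg k hs, ?_⟩,
    hG 0⟩
  refine hasDerivAt_of_abs_sub_le_sq (C := C (k + 2) (s / 2)) ?_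
  filter_upwards [Ioi_mem_nhds (show s / 2 < s by linarith)] with t ht
  have ht' : s / 2 < t := ht
  have h1 := (((hG k t (by linarith)).sub (hG k s hs)).add
    ((hG (k + 1) s hs).mul_const (t - s))).abs
  rw [neg_mul, sub_neg_eq_add]
  refine le_of_tendsto' h1 fun m => ?_
  refine ((hg (φ m)).taylor_le k (r := s / 2) (by linarith) (by linarith) ht'.le).trans ?_
  exact mul_le_mul_of_nonneg_right (hC _ _ (by linarith) _) (sq_nonneg _)

theorem tendsto_comp_of_antitoneOn {f : ℕ → ℝ → ℝ} {F : ℝ → ℝ} {u : ℕ → ℝ} {s : ℝ} (hs : 0 < s)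
    (hf : ∀ m, AntitoneOn (f m) (Ioi 0)) (hF : ContinuousAt F s)
    (hlim : ∀ t > 0, Tendsto (fun m => f m t) atTop (𝓝 (F t))) (hu : Tendsto u atTop (𝓝 s)) :
    Tendsto (fun m => f m (u m)) atTop (𝓝 (F s)) := by
  have hu0 : ∀ᶠ m in atTop, 0 < u m := hu.eventually (lt_mem_nhds hs)
  refine tendsto_order.2 ⟨fun a ha => ?_, fun a ha => ?_⟩
  · have h1 : ∀ᶠ t in 𝓝[>] s, a < F t := (hF.eventually (lt_mem_nhds ha)).filter_mono inf_le_left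
    obtain ⟨t, ht, hst⟩ := (h1.and self_mem_nhdsWithin).exists
    have hst : s < t := hst
    have ht0 : 0 < t := hs.trans hst
    filter_upwards [hu0, hu.eventually (gt_mem_nhds hst),
      (hlim t ht0).eventually (lt_mem_nhds ht)] with m h0 h1 h2
    exact h2.trans_le (hf m h0 ht0 h1.le)
  · have h1 : ∀ᶠ t in 𝓝[<] s, F t < a ∧ 0 < t :=
      ((hF.eventually (gt_mem_nhds ha)).and (lt_mem_nhds hs)).filter_mono inf_le_left
    obtain ⟨t, ⟨ht, ht0⟩, hst⟩ := (h1.and self_mem_nhdsWithin).exists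
    have hst : t < s := hst
    filter_upwards [hu0, hu.eventually (lt_mem_nhds hst),
      (hlim t ht0).eventually (gt_mem_nhds ht)] with m h0 h1 h2
    exact (hf m ht0 h0 h1.le).trans_lt h2

theorem sum_Ico_eq_integral_floor (c : ℕ → ℝ) {M : ℝ} (hM : 0 < M) {p q : ℕ} (hpq : p ≤ q) :
    M⁻¹ * ∑ j ∈ Finset.Ico p q, c j = ∫ s in (p / M : ℝ)..(q / M), c ⌊s * M⌋₊ := by
  have hcell : ∀ j : ℕ, EqOn (fun s => c ⌊s * M⌋₊) (fun _ => c j)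
      (Ico ((j : ℝ) / M) (((j + 1 : ℕ) : ℝ) / M)) := by
    intro j s hs
    have h1 : (j : ℝ) ≤ s * M := (div_le_iff₀ hM).1 hs.1
    have h2 : s * M < (j : ℝ) + 1 := by
      have := (lt_div_iff₀ hM).1 hs.2
      push_cast at this
      exact this
    have : ⌊s * M⌋₊ = j := (Nat.floor_eq_iff (le_trans (Nat.cast_nonneg j) h1)).2 ⟨h1, h2⟩
    simp only [this]
  have hle : ∀ j : ℕ, (j : ℝ) / M ≤ ((j + 1 : ℕ) : ℝ) / M := fun j => by
    gcongr
    exact Nat.le_succ j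
  rw [← intervalIntegral.sum_integral_adjacent_intervals_Ico (a := fun j : ℕ => (j : ℝ) / M) hpq,
    Finset.mul_sum]
  · refine Finset.sum_congr rfl fun j _ => ?_
    rw [intervalIntegral.integral_of_le (hle j), ← integral_Ico_eq_integral_Ioc,
      setIntegral_congr_fun measurableSet_Ico (hcell j), setIntegral_const, smul_eq_mul,
      Real.volume_real_Ico_of_le (hle j)]
    push_cast
    field_simp
    ring
  · intro j _
    rw [intervalIntegrable_iff_integrableOn_Ico_of_le (hle j)]
    exact (integrableOn_const (by simp)).congr_fun (hcell j).symm measurableSet_Ico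

theorem tendsto_riemann_sum {c : ℕ → ℕ → ℝ} {M : ℕ → ℝ} {p q : ℕ → ℕ} {a b C : ℝ} {f : ℝ → ℝ}
    (ha : 0 < a) (hab : a < b) (hM : ∀ m, 0 < M m) (hpq : ∀ m, p m ≤ q m)
    (hp : Tendsto (fun m => (p m : ℝ) / M m) atTop (𝓝 a))
    (hq : Tendsto (fun m => (q m : ℝ) / M m) atTop (𝓝 b))
    (hC : ∀ᶠ m in atTop, ∀ j, p m ≤ j → j < q m → |c m j| ≤ C)
    (hf : ∀ s ∈ Ioo a b, Tendsto (fun m => c m ⌊s * M m⌋₊) atTop (𝓝 (f s))) :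
    Tendsto (fun m => (M m)⁻¹ * ∑ j ∈ Finset.Ico (p m) (q m), c m j) atTop
      (𝓝 (∫ s in a..b, f s)) := by
  have hle : ∀ m, (p m : ℝ) / M m ≤ (q m : ℝ) / M m := fun m =>
    div_le_div_of_nonneg_right (by exact_mod_cast hpq m) (hM m).le
  have e1 : ∀ m, (M m)⁻¹ * ∑ j ∈ Finset.Ico (p m) (q m), c m j
      = ∫ s, (Ico ((p m : ℝ) / M m) (q m / M m)).indicator (fun s => c m ⌊s * M m⌋₊) s := by
    intro m
    rw [sum_Ico_eq_integral_floor _ (hM m) (hpq m), intervalIntegral.integral_of_le (hle m),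
      ← integral_Ico_eq_integral_Ioc, integral_indicator measurableSet_Ico]
  have e2 : ∫ s in a..b, f s = ∫ s, (Ioo a b).indicator f s := by
    rw [intervalIntegral.integral_of_le hab.le, integral_Ioc_eq_integral_Ioo,
      integral_indicator measurableSet_Ioo]
  have hC0 : 0 ≤ |C| := abs_nonneg C
  simp_rw [e1, e2]
  refine tendsto_integral_filter_of_dominated_convergence
    ((Ioc 0 (b + 1)).indicator fun _ => |C|) ?_ ?_ ?_ ?_
  · refine Eventually.of_forall fun m => ?_
    refine (Measurable.indicator ?_ measurableSet_Ico).aestronglyMeasurable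
    exact (measurable_from_nat (f := c m)).comp
      (Nat.measurable_floor.comp (measurable_id.mul_const (M m)))
  · filter_upwards [hC, hp.eventually (lt_mem_nhds ha),
      hq.eventually (gt_mem_nhds (show b < b + 1 by linarith))] with m h1 h2 h3
    refine Eventually.of_forall fun s => ?_
    by_cases hs : s ∈ Ico ((p m : ℝ) / M m) (q m / M m)
    · have hs0 : 0 < s := h2.trans_le hs.1
      rw [indicator_of_mem hs, indicator_of_mem (show s ∈ Ioc 0 (b + 1) from ⟨hs0, (hs.2.trans h3).le⟩)]
      refine (h1 _ (Nat.le_floor ((div_le_iff₀ (hM m)).1 hs.1)) ?_).trans (le_abs_self C)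
      exact (Nat.floor_lt (mul_pos hs0 (hM m)).le).2 ((lt_div_iff₀ (hM m)).1 hs.2)
    · rw [indicator_of_notMem hs, norm_zero]
      exact indicator_nonneg (fun _ _ => hC0) s
  · exact (integrable_indicator_iff measurableSet_Ioc).2 (integrableOn_const (by simp))
  · have hae : ∀ᵐ s : ℝ, s ≠ a ∧ s ≠ b := by
      have h1 : ∀ᵐ s : ℝ, s ≠ a := by simp [ae_iff]
      have h2 : ∀ᵐ s : ℝ, s ≠ b := by simp [ae_iff]
      exact h1.and h2
    filter_upwards [hae] with s hs
    rcases lt_or_gt_of_ne hs.1 with h | h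
    · rw [indicator_of_notMem fun h' => absurd h'.1 (not_lt.2 h.le)]
      refine tendsto_const_nhds.congr' ?_
      filter_upwards [hp.eventually (lt_mem_nhds h)] with m hm
      rw [indicator_of_notMem fun h' => absurd h'.1 (not_le.2 hm)]
    rcases lt_or_gt_of_ne hs.2 with h' | h'
    · rw [indicator_of_mem (show s ∈ Ioo a b from ⟨h, h'⟩)]
      refine (hf s ⟨h, h'⟩).congr' ?_
      filter_upwards [hp.eventually (gt_mem_nhds h), hq.eventually (lt_mem_nhds h')] with m h1 h2
      rw [indicator_of_mem (show s ∈ Ico ((p m : ℝ) / M m) (q m / M m) from ⟨h1.le, h2⟩)]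
    · rw [indicator_of_notMem fun h'' => absurd h''.2 (not_lt.2 h'.le)]
      refine tendsto_const_nhds.congr' ?_
      filter_upwards [hq.eventually (gt_mem_nhds h')] with m hm
      rw [indicator_of_notMem fun h'' => absurd h''.2 (not_lt.2 hm.le)]

theorem tendsto_floor_mul_div {M : ℕ → ℝ} (hMt : Tendsto M atTop atTop)
    {s : ℝ} (hs : 0 ≤ s) : Tendsto (fun m => (⌊s * M m⌋₊ : ℝ) / M m) atTop (𝓝 s) :=
  (tendsto_nat_floor_mul_div_atTop hs).comp hMt

theorem tendsto_integral_left {f : ℝ → ℝ} {b : ℝ} (hb : 0 < b) (hf : IntegrableOn f (Ioc 0 b)) :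
    Tendsto (fun e => ∫ s in e..b, f s) (𝓝[>] 0) (𝓝 (∫ s in (0 : ℝ)..b, f s)) := by
  have h := intervalIntegral.continuousOn_primitive_interval_left (μ := volume) (f := f)
    (a := 0) (b := b) (by rwa [uIcc_of_le hb.le, integrableOn_Icc_iff_integrableOn_Ioc])
  rw [uIcc_of_le hb.le] at h
  refine (h 0 (left_mem_Icc.2 hb.le)).mono_left ?_
  rw [← nhdsWithin_Ioc_eq_nhdsGT hb]
  exact nhdsWithin_mono _ Ioc_subset_Icc_self

theorem integrableOn_Ioc_of_integrableOn_Ioc_one {f : ℝ → ℝ} (hf : ContinuousOn f (Ioi 0))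
    (h : IntegrableOn f (Ioc 0 1)) (t : ℝ) : IntegrableOn f (Ioc 0 t) := by
  have h1 : IntegrableOn f (Icc 1 t) :=
    (hf.mono fun s hs => zero_lt_one.trans_le hs.1).integrableOn_Icc
  refine (h.union h1).mono_set fun s hs => ?_
  rcases le_total s 1 with h' | h'
  · exact Or.inl ⟨hs.1, h'⟩
  · exact Or.inr ⟨h', hs.2⟩

theorem integrableOn_conv {κ F : ℝ → ℝ} {t : ℝ} (hmono : MonotoneOn κ (Ioi 0))
    (hcont : ContinuousOn κ (Ioi 0)) (hnn : ∀ s > 0, 0 ≤ κ s) (hFc : ContinuousOn F (Ioi 0))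
    (hF : IntegrableOn F (Ioc 0 t)) : IntegrableOn (fun s => κ (t - s) * F s) (Ioc 0 t) := by
  rw [integrableOn_Ioc_iff_integrableOn_Ioo] at hF ⊢
  refine Integrable.mono' (hF.norm.const_mul (κ t)) ?_ ?_
  · refine ContinuousOn.aestronglyMeasurable (ContinuousOn.mul ?_ ?_) measurableSet_Ioo
    · exact hcont.comp (by fun_prop) fun s hs => sub_pos.2 hs.2
    · exact hFc.mono fun s hs => hs.1
  · refine (ae_restrict_iff' measurableSet_Ioo).2 (Eventually.of_forall fun s hs => ?_)
    have h1 : 0 < t - s := sub_pos.2 hs.2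
    rw [norm_mul, Real.norm_of_nonneg (hnn _ h1)]
    exact mul_le_mul_of_nonneg_right (hmono h1 (hs.1.trans hs.2) (by linarith [hs.1]))
      (norm_nonneg _)

section Limit

variable {κ F : ℝ → ℝ} {M : ℕ → ℝ} {B : ℕ → ℕ → ℝ}

/-- Passage to the limit in the discretized convolution equation. -/
theorem exists_solution_of_discrete (hmono : MonotoneOn κ (Ioi 0)) (hcont : ContinuousOn κ (Ioi 0))
    (hpos : ∀ t > 0, 0 < κ t) (hM : ∀ m, 0 < M m) (hMt : Tendsto M atTop atTop)
    (hB0 : ∀ m j, 0 ≤ B m j) (hBa : ∀ m, Antitone (B m))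
    (heq : ∀ m n, ∑ j ∈ Finset.range (n + 1), κ (((n - j : ℕ) + 2) * (M m)⁻¹) * B m j = n + 1)
    (hF0 : ∀ s > 0, 0 ≤ F s) (hFc : ContinuousOn F (Ioi 0))
    (hlim : ∀ s > 0, Tendsto (fun m => B m ⌊s * M m⌋₊) atTop (𝓝 (F s))) :
    ∃ b, 0 ≤ b ∧ IntegrableOn F (Ioc 0 1) ∧
      ∀ t > 0, b * κ t + ∫ s in (0 : ℝ)..t, κ s * F (t - s) = t := by
  set Λ : ℝ → ℕ → ℝ := fun e m => (M m)⁻¹ * ∑ j ∈ Finset.range ⌊e * M m⌋₊, B m j with hΛ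
  have hΛ0 : ∀ e m, 0 ≤ Λ e m := fun e m =>
    mul_nonneg (inv_nonneg.2 (hM m).le) (Finset.sum_nonneg fun _ _ => hB0 _ _)
  have hinv : Tendsto (fun m => (M m)⁻¹) atTop (𝓝 0) := tendsto_inv_atTop_zero.comp hMt
  have hfl := fun {s : ℝ} (hs : 0 ≤ s) => tendsto_floor_mul_div hMt hs
  have hκat : ∀ t > 0, ContinuousAt κ t := fun t ht => hcont.continuousAt (Ioi_mem_nhds ht)
  -- the part of the sum away from the singularity of `F`
  have hJ : ∀ e t, 0 < e → e < t → Tendsto (fun m => (M m)⁻¹ *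
      ∑ j ∈ Finset.Ico ⌊e * M m⌋₊ (⌊t * M m⌋₊ + 1),
        κ (((⌊t * M m⌋₊ - j : ℕ) + 2) * (M m)⁻¹) * B m j) atTop
      (𝓝 (∫ s in e..t, κ (t - s) * F s)) := by
    intro e t he het
    have ht0 : 0 < t := he.trans het
    have hq : Tendsto (fun m => ((⌊t * M m⌋₊ + 1 : ℕ) : ℝ) / M m) atTop (𝓝 t) := by
      have := (hfl ht0.le).add hinv
      rw [add_zero] at this
      refine this.congr fun m => ?_
      push_cast
      ring
    refine tendsto_riemann_sum (C := κ (t + 1) * (F e + 1)) he het hM (fun m => ?_) (hfl he.le) hq ?_ ?_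
    · exact (Nat.floor_le_floor (mul_le_mul_of_nonneg_right het.le (hM m).le)).trans (Nat.le_succ _)
    · have hsmall : ∀ᶠ m in atTop, (⌊t * M m⌋₊ : ℝ) / M m + 2 * (M m)⁻¹ < t + 1 := by
        have := (hfl ht0.le).add (hinv.const_mul 2)
        exact this.eventually (gt_mem_nhds (by linarith))
      filter_upwards [hsmall, (hlim e he).eventually (gt_mem_nhds (show F e < F e + 1 by linarith))]
        with m h1 h2 j hj1 hj2
      have hi : 0 < (M m)⁻¹ := inv_pos.2 (hM m)
      have harg : 0 < ((⌊t * M m⌋₊ - j : ℕ) + 2) * (M m)⁻¹ := by positivity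
      rw [abs_of_nonneg (mul_nonneg (hpos _ harg).le (hB0 _ _))]
      refine mul_le_mul (hmono harg (show (0 : ℝ) < t + 1 by linarith) ?_)
        ((hBa m hj1).trans h2.le) (hB0 _ _) (hpos _ (by linarith)).le
      have : ((⌊t * M m⌋₊ - j : ℕ) : ℝ) ≤ ⌊t * M m⌋₊ := by exact_mod_cast Nat.sub_le _ _
      refine le_trans ?_ h1.le
      rw [add_mul, div_eq_mul_inv]
      gcongr
    · intro s hs
      have hs0 : 0 < s := he.trans hs.1
      refine Tendsto.mul ?_ (hlim s hs0)
      refine (hκat (t - s) (sub_pos.2 hs.2)).tendsto.comp ?_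
      have := ((hfl ht0.le).sub (hfl hs0.le)).add (hinv.const_mul 2)
      rw [mul_zero, add_zero] at this
      refine this.congr fun m => ?_
      rw [Nat.cast_sub (Nat.floor_le_floor (mul_le_mul_of_nonneg_right hs.2.le (hM m).le))]
      ring
  have hI : ∀ e, 0 < e → e < 1 → Tendsto (fun m => Λ 1 m - Λ e m) atTop
      (𝓝 (∫ s in e..1, F s)) := by
    intro e he he1
    have hle : ∀ m, ⌊e * M m⌋₊ ≤ ⌊1 * M m⌋₊ := fun m =>
      Nat.floor_le_floor (mul_le_mul_of_nonneg_right he1.le (hM m).le)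
    refine (tendsto_riemann_sum (c := B) (C := F e + 1) he he1 hM hle (hfl he.le) (hfl zero_le_one)
      ?_ fun s hs => hlim s (he.trans hs.1)).congr fun m => ?_
    · filter_upwards [(hlim e he).eventually (gt_mem_nhds (show F e < F e + 1 by linarith))]
        with m h2 j hj1 _
      rw [abs_of_nonneg (hB0 _ _)]
      exact (hBa m hj1).trans h2.le
    · rw [hΛ, Finset.sum_Ico_eq_sub _ (hle m)]
      ring
  -- two-sided control of the singular part
  have hbounds : ∀ e t, 0 < e → e < t → ∀ m,
      κ ((((⌊t * M m⌋₊ : ℝ) - ⌊e * M m⌋₊) + 2) * (M m)⁻¹) * Λ e m ≤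
        (M m)⁻¹ * (⌊t * M m⌋₊ + 1) - (M m)⁻¹ *
          ∑ j ∈ Finset.Ico ⌊e * M m⌋₊ (⌊t * M m⌋₊ + 1),
            κ (((⌊t * M m⌋₊ - j : ℕ) + 2) * (M m)⁻¹) * B m j ∧
      (M m)⁻¹ * (⌊t * M m⌋₊ + 1) - (M m)⁻¹ *
          ∑ j ∈ Finset.Ico ⌊e * M m⌋₊ (⌊t * M m⌋₊ + 1),
            κ (((⌊t * M m⌋₊ - j : ℕ) + 2) * (M m)⁻¹) * B m j ≤
        κ (((⌊t * M m⌋₊ : ℝ) + 2) * (M m)⁻¹) * Λ e m := by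
    intro e t he het m
    have hle : ⌊e * M m⌋₊ ≤ ⌊t * M m⌋₊ :=
      Nat.floor_le_floor (mul_le_mul_of_nonneg_right het.le (hM m).le)
    have hi : 0 < (M m)⁻¹ := inv_pos.2 (hM m)
    have hsplit : (M m)⁻¹ * (⌊t * M m⌋₊ + 1) - (M m)⁻¹ *
          ∑ j ∈ Finset.Ico ⌊e * M m⌋₊ (⌊t * M m⌋₊ + 1),
            κ (((⌊t * M m⌋₊ - j : ℕ) + 2) * (M m)⁻¹) * B m j
        = (M m)⁻¹ * ∑ j ∈ Finset.range ⌊e * M m⌋₊,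
            κ (((⌊t * M m⌋₊ - j : ℕ) + 2) * (M m)⁻¹) * B m j := by
      rw [← heq m ⌊t * M m⌋₊, Finset.sum_Ico_eq_sub _ (hle.trans (Nat.le_succ _))]
      ring
    rw [hsplit, hΛ]
    dsimp only
    rw [mul_left_comm, mul_left_comm (κ _), Finset.mul_sum (Finset.range ⌊e * M m⌋₊) (B m),
      Finset.mul_sum (Finset.range ⌊e * M m⌋₊) (B m)]
    constructor
    · refine mul_le_mul_of_nonneg_left (Finset.sum_le_sum fun j hj => ?_) hi.le
      have hj := (Finset.mem_range.1 hj).le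
      refine mul_le_mul_of_nonneg_right ?_ (hB0 _ _)
      have h1 : (⌊t * M m⌋₊ : ℝ) - ⌊e * M m⌋₊ ≤ ((⌊t * M m⌋₊ - j : ℕ) : ℝ) := by
        rw [← Nat.cast_sub hle]
        exact_mod_cast Nat.sub_le_sub_left hj _
      have h0 : (0 : ℝ) ≤ (⌊t * M m⌋₊ : ℝ) - ⌊e * M m⌋₊ := sub_nonneg.2 (by exact_mod_cast hle)
      exact hmono (show (0 : ℝ) < _ by positivity) (show (0 : ℝ) < _ by positivity) (by gcongr)
    · refine mul_le_mul_of_nonneg_left (Finset.sum_le_sum fun j _ => ?_) hi.le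
      refine mul_le_mul_of_nonneg_right ?_ (hB0 _ _)
      have h1 : ((⌊t * M m⌋₊ - j : ℕ) : ℝ) ≤ ⌊t * M m⌋₊ := by exact_mod_cast Nat.sub_le _ _
      exact hmono (show (0 : ℝ) < _ by positivity) (show (0 : ℝ) < _ by positivity) (by gcongr)
  have hmid : ∀ t, 0 < t → Tendsto (fun m => (M m)⁻¹ * (⌊t * M m⌋₊ + 1)) atTop (𝓝 t) := by
    intro t ht
    have := (hfl ht.le).add hinv
    rw [add_zero] at this
    refine this.congr fun m => ?_
    ring
  have hκ1 : ∀ e t, 0 < e → e < t → Tendsto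
      (fun m => κ ((((⌊t * M m⌋₊ : ℝ) - ⌊e * M m⌋₊) + 2) * (M m)⁻¹)) atTop (𝓝 (κ (t - e))) := by
    intro e t he het
    refine (hκat (t - e) (sub_pos.2 het)).tendsto.comp ?_
    have := ((hfl (he.trans het).le).sub (hfl he.le)).add (hinv.const_mul 2)
    rw [mul_zero, add_zero] at this
    refine this.congr fun m => ?_
    ring
  have hκ2 : ∀ t, 0 < t → Tendsto
      (fun m => κ (((⌊t * M m⌋₊ : ℝ) + 2) * (M m)⁻¹)) atTop (𝓝 (κ t)) := by
    intro t ht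
    refine (hκat t ht).tendsto.comp ?_
    have := (hfl ht.le).add (hinv.const_mul 2)
    rw [mul_zero, add_zero] at this
    refine this.congr fun m => ?_
    ring
  -- a limit point of the masses of `(0,1)`
  obtain ⟨l, hl, hle, ℓ, hℓ⟩ : ∃ l : Filter ℕ, l.NeBot ∧ l ≤ atTop ∧ ∃ ℓ,
      Tendsto (Λ 1) l (𝓝 ℓ) := by
    have hbd : ∀ᶠ m in atTop, Λ 1 m ∈ Icc 0 ((2 + 1) / (κ 1 / 2)) := by
      have h21 : (2 : ℝ) - 1 = 1 := by norm_num
      have hk := hκ1 1 2 one_pos one_lt_two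
      rw [h21] at hk
      filter_upwards [hk.eventually (lt_mem_nhds (show κ 1 / 2 < κ 1 by linarith [hpos 1 one_pos])),
        (hmid 2 two_pos).eventually (gt_mem_nhds (show (2 : ℝ) < 2 + 1 by norm_num))] with m h1 h2
      refine ⟨hΛ0 1 m, ?_⟩
      rw [le_div_iff₀ (by linarith [hpos 1 one_pos])]
      have h3 := (hbounds 1 2 one_pos one_lt_two m).1
      have h4 : 0 ≤ (M m)⁻¹ * ∑ j ∈ Finset.Ico ⌊1 * M m⌋₊ (⌊2 * M m⌋₊ + 1),
            κ (((⌊2 * M m⌋₊ - j : ℕ) + 2) * (M m)⁻¹) * B m j := by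
        have hi : 0 < (M m)⁻¹ := inv_pos.2 (hM m)
        refine mul_nonneg hi.le (Finset.sum_nonneg fun j _ => mul_nonneg ?_ (hB0 _ _))
        exact (hpos _ (by positivity)).le
      have h5 := mul_le_mul_of_nonneg_right h1.le (hΛ0 1 m)
      linarith
    obtain ⟨ℓ, -, φ, hφ, hlim'⟩ := tendsto_subseq_of_frequently_bounded
      (Metric.isBounded_Icc (0 : ℝ) ((2 + 1) / (κ 1 / 2))) hbd.frequently
    exact ⟨map φ atTop, inferInstance, hφ.tendsto_atTop, ℓ, tendsto_map'_iff.2 hlim'⟩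
  have hΛe : ∀ e, 0 < e → e < 1 → Tendsto (Λ e) l (𝓝 (ℓ - ∫ s in e..1, F s)) := by
    intro e he he1
    refine (hℓ.sub ((hI e he he1).mono_left hle)).congr fun m => ?_
    ring
  have hIΛ : ∀ e, 0 < e → e < 1 → ∫ s in e..1, F s ≤ ℓ := fun e he he1 => by
    have := ge_of_tendsto' (hΛe e he he1) (hΛ0 e)
    linarith
  have hint : IntegrableOn F (Ioc 0 1) := by
    have ha : ∀ n : ℕ, 0 < 1 / ((n : ℝ) + 1 + 1) ∧ 1 / ((n : ℝ) + 1 + 1) < 1 := fun n =>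
      ⟨by positivity, by rw [div_lt_one (by positivity)]; linarith [n.cast_nonneg (α := ℝ)]⟩
    refine integrableOn_Ioc_of_intervalIntegral_norm_bounded_left (I := ℓ)
      (a := fun n : ℕ => 1 / ((n : ℝ) + 1 + 1)) (l := atTop) (fun n => ?_) ?_
      (Eventually.of_forall fun n => ?_)
    · refine ContinuousOn.integrableOn_Icc (hFc.mono fun s hs => ?_) |>.mono_set Ioc_subset_Icc_self
      exact (ha n).1.trans_le hs.1
    · have := (tendsto_add_atTop_iff_nat 1).2 (tendsto_one_div_add_atTop_nhds_zero_nat (𝕜 := ℝ))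
      simpa only [Nat.cast_add, Nat.cast_one] using this
    · refine le_trans (le_of_eq ?_) (hIΛ _ (ha n).1 (ha n).2)
      rw [intervalIntegral.integral_of_le (ha n).2.le]
      refine setIntegral_congr_fun measurableSet_Ioc fun s hs => ?_
      exact Real.norm_of_nonneg (hF0 s ((ha n).1.trans hs.1))
  have hIlim : Tendsto (fun e => ∫ s in e..1, F s) (𝓝[>] 0) (𝓝 (∫ s in (0 : ℝ)..1, F s)) :=
    tendsto_integral_left zero_lt_one hint
  have hsmall : ∀ c : ℝ, 0 < c → ∀ᶠ e : ℝ in 𝓝[>] 0, 0 < e ∧ e < c := fun c hc => by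
    filter_upwards [Ioo_mem_nhdsGT hc] with e he using he
  refine ⟨ℓ - ∫ s in (0 : ℝ)..1, F s, ?_, hint, fun t ht => ?_⟩
  · refine sub_nonneg.2 (le_of_tendsto hIlim ?_)
    filter_upwards [hsmall 1 one_pos] with e he using hIΛ e he.1 he.2
  have hFt : IntegrableOn F (Ioc 0 t) := integrableOn_Ioc_of_integrableOn_Ioc_one hFc hint t
  have hconv : IntegrableOn (fun s => κ (t - s) * F s) (Ioc 0 t) :=
    integrableOn_conv hmono hcont (fun s hs => (hpos s hs).le) hFc hFt
  have hmain : ∀ e, 0 < e → e < t → e < 1 →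
      κ (t - e) * (ℓ - ∫ s in e..1, F s) ≤ t - ∫ s in e..t, κ (t - s) * F s ∧
      t - ∫ s in e..t, κ (t - s) * F s ≤ κ t * (ℓ - ∫ s in e..1, F s) := by
    intro e he het he1
    have h1 := ((hmid t ht).sub (hJ e t he het)).mono_left hle
    exact ⟨le_of_tendsto_of_tendsto' (((hκ1 e t he het).mono_left hle).mul (hΛe e he he1)) h1
        fun m => (hbounds e t he het m).1,
      le_of_tendsto_of_tendsto' h1 (((hκ2 t ht).mono_left hle).mul (hΛe e he he1))
        fun m => (hbounds e t he het m).2⟩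
  have h0 : Tendsto (fun e : ℝ => e) (𝓝[>] 0) (𝓝 0) := nhdsWithin_le_nhds
  have hb := tendsto_const_nhds.sub hIlim (a := ℓ)
  have hmidlim := tendsto_const_nhds.sub (tendsto_integral_left ht hconv) (a := t)
  have hκe : Tendsto (fun e => κ (t - e)) (𝓝[>] 0) (𝓝 (κ t)) := by
    refine (hκat t ht).tendsto.comp ?_
    simpa using tendsto_const_nhds.sub h0 (a := t)
  have hall : ∀ᶠ e in 𝓝[>] (0 : ℝ), 0 < e ∧ e < t ∧ e < 1 := by
    filter_upwards [hsmall t ht, hsmall 1 one_pos] with e h1 h2 using ⟨h1.1, h1.2, h2.2⟩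
  have hlow := le_of_tendsto_of_tendsto (hκe.mul hb) hmidlim
    (hall.mono fun e he => (hmain e he.1 he.2.1 he.2.2).1)
  have hupp := le_of_tendsto_of_tendsto hmidlim (tendsto_const_nhds.mul hb)
    (hall.mono fun e he => (hmain e he.1 he.2.1 he.2.2).2)
  have hflip := intervalIntegral.integral_comp_sub_left (a := 0) (b := t)
    (fun s => κ s * F (t - s)) t
  simp only [sub_sub_cancel, sub_self, sub_zero] at hflip
  rw [← hflip]
  linarith

end Limit

section Bernstein

variable {κ : ℝ → ℝ} {g : ℕ → ℝ → ℝ}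

theorem monotoneOn_of_cmFamily_deriv (hg : CMFamily g) (hκ : ∀ t > 0, HasDerivAt κ (g 0 t) t) :
    MonotoneOn κ (Ioi 0) := by
  refine monotoneOn_of_deriv_nonneg (convex_Ioi 0)
    (fun t ht => (hκ t ht).continuousAt.continuousWithinAt) ?_ ?_
  · rw [interior_Ioi]
    exact fun t ht => (hκ t ht).differentiableAt.differentiableWithinAt
  · rw [interior_Ioi]
    intro t ht
    rw [(hκ t ht).deriv]
    exact hg.nonneg 0 ht

/-- A nonnegative function with completely monotone derivative that vanishes at one point is
identically zero. -/
theorem pos_of_cmFamily_deriv (hg : CMFamily g) (hκ : ∀ t > 0, HasDerivAt κ (g 0 t) t)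
    (hnn : ∀ t > 0, 0 ≤ κ t) (hnz : ∃ t > 0, κ t ≠ 0) : ∀ t > 0, 0 < κ t := by
  have hmono := monotoneOn_of_cmFamily_deriv hg hκ
  have hmvt : ∀ a b, 0 < a → a < b → ∃ c ∈ Ioo a b, g 0 c = (κ b - κ a) / (b - a) :=
    fun a b ha hab => exists_hasDerivAt_eq_slope κ (g 0) hab
      (fun t ht => (hκ t (ha.trans_le ht.1)).continuousAt.continuousWithinAt)
      fun t ht => hκ t (ha.trans ht.1)
  intro s hs
  refine (hnn s hs).lt_of_ne' fun h0 => ?_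
  obtain ⟨t, ht, hne⟩ := hnz
  have hpos : 0 < κ t := (hnn t ht).lt_of_ne' hne
  have hst : s < t := by
    by_contra! h
    linarith [hmono ht hs h]
  have h2 : κ (s / 2) = 0 :=
    le_antisymm (h0 ▸ hmono (half_pos hs) hs (half_lt_self hs).le) (hnn _ (half_pos hs))
  obtain ⟨c, hc, hc'⟩ := hmvt (s / 2) s (half_pos hs) (half_lt_self hs)
  obtain ⟨d, hd, hd'⟩ := hmvt s t hs hst
  rw [h0, h2, sub_zero, zero_div] at hc'
  rw [h0, sub_zero] at hd'
  have h3 : 0 < g 0 d := hd' ▸ div_pos hpos (sub_pos.2 hst)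
  have h4 := hg.antitoneOn 0 (a := c) (b := d) ((half_pos hs).trans hc.1) (hs.trans hd.1)
    (hc.2.trans hd.1).le
  linarith

theorem resolvent_le_of_discrete (hmono : MonotoneOn κ (Ioi 0)) (hpos : ∀ t > 0, 0 < κ t)
    {B : ℕ → ℝ} (hB : CMSeq B) {h : ℝ} (hh : 0 < h)
    (heq : ∀ n, ∑ j ∈ Finset.range (n + 1), κ (((n - j : ℕ) + 2) * h) * B j = n + 1)
    {s : ℝ} (hs : 0 < s) {n : ℕ} (hn : s ≤ n * h) : B n ≤ 2 / κ s := by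
  have h1 : ∑ j ∈ Finset.range (n + 1), κ s * B n ≤
      ∑ j ∈ Finset.range (2 * n + 1), κ (((2 * n - j : ℕ) + 2) * h) * B j := by
    refine (Finset.sum_le_sum fun j hj => ?_).trans
      (Finset.sum_le_sum_of_subset_of_nonneg (Finset.range_mono (by omega)) fun j _ _ => ?_)
    · have hj : j ≤ n := by simpa [Nat.lt_succ_iff] using hj
      refine mul_le_mul (hmono hs (show (0 : ℝ) < _ by positivity) (hn.trans ?_)) (hB.antitone hj)
        (hB.nonneg n) (hpos _ (by positivity)).le
      have : (n : ℝ) ≤ ((2 * n - j : ℕ) : ℝ) := by exact_mod_cast (by omega : n ≤ 2 * n - j)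
      exact mul_le_mul_of_nonneg_right (by linarith) hh.le
    · exact mul_nonneg (hpos _ (by positivity)).le (hB.nonneg j)
  rw [heq, Finset.sum_const, Finset.card_range, nsmul_eq_mul] at h1
  push_cast at h1
  rw [le_div_iff₀ (hpos s hs)]
  have hn0 : (0 : ℝ) < (n : ℝ) + 1 := by positivity
  refine le_of_mul_le_mul_left ?_ hn0
  nlinarith

/-- Existence of a completely monotone resolvent, with a point mass at the origin. -/
theorem exists_cmFamily_solution (hg : CMFamily g) (hκ : ∀ t > 0, HasDerivAt κ (g 0 t) t)
    (hpos : ∀ t > 0, 0 < κ t) :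
    ∃ (b : ℝ) (G : ℕ → ℝ → ℝ), 0 ≤ b ∧ CMFamily G ∧ IntegrableOn (G 0) (Ioc 0 1) ∧
      ∀ t > 0, b * κ t + ∫ s in (0 : ℝ)..t, κ s * G 0 (t - s) = t := by
  have hmono := monotoneOn_of_cmFamily_deriv hg hκ
  have hcont : ContinuousOn κ (Ioi 0) := fun t ht =>
    (hκ t ht).continuousAt.continuousWithinAt
  have hM0 : ∀ m : ℕ, 0 < ((m + 1 : ℕ) : ℝ) := fun m => by positivity
  choose B hB heq using fun m : ℕ =>
    hg.exists_discrete_resolvent hκ hmono hpos (inv_pos.2 (hM0 m))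
  choose f hf hfB using fun m : ℕ => (hB m).exists_cmFamily_approx (M := m + 1) m.succ_pos
    ((m + 1) ^ 2) (inv_pos.2 (hM0 m))
  have hMt : Tendsto (fun m : ℕ => ((m + 1 : ℕ) : ℝ)) atTop atTop :=
    tendsto_natCast_atTop_atTop.comp (tendsto_add_atTop_nat 1)
  -- for fixed `t`, the grid point just below `t` is eventually in the range of approximation
  have hrange : ∀ t > (0 : ℝ), ∀ᶠ m : ℕ in atTop, 1 ≤ ⌊t * ((m + 1 : ℕ) : ℝ)⌋₊ ∧
      ⌊t * ((m + 1 : ℕ) : ℝ)⌋₊ ≤ (m + 1) ^ 2 := by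
    intro t ht
    filter_upwards [hMt.eventually_ge_atTop t⁻¹, hMt.eventually_ge_atTop t] with m h1 h2
    constructor
    · rw [Nat.one_le_floor_iff]
      calc (1 : ℝ) = t * t⁻¹ := (mul_inv_cancel₀ ht.ne').symm
        _ ≤ _ := mul_le_mul_of_nonneg_left h1 ht.le
    · refine Nat.floor_le_of_le ?_
      rw [Nat.cast_pow, pow_two]
      exact mul_le_mul_of_nonneg_right h2 (hM0 m).le
  have hgrid : ∀ t > (0 : ℝ), Tendsto (fun m : ℕ => (⌊t * ((m + 1 : ℕ) : ℝ)⌋₊ : ℝ) / (m + 1 : ℕ)) atTop (𝓝 t) :=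
    fun t ht => tendsto_floor_mul_div hMt ht.le
  have hbdd : ∀ t > 0, ∃ C, ∀ m, f m 0 t ≤ C := by
    intro t ht
    have hev : ∀ᶠ m in atTop, f m 0 t ≤ 2 / κ (t / 2) + 1 := by
      filter_upwards [hrange t ht, (hgrid t ht).eventually (lt_mem_nhds (half_lt_self ht))]
        with m h1 h2
      have h3 := hfB m _ h1.1 h1.2
      have h4 : B m ⌊t * ((m + 1 : ℕ) : ℝ)⌋₊ ≤ 2 / κ (t / 2) :=
        resolvent_le_of_discrete hmono hpos (hB m) (inv_pos.2 (hM0 m)) (heq m) (half_pos ht)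
          (by rw [← div_eq_mul_inv]; exact h2.le)
      have h5 : (((m + 1 : ℕ) : ℝ))⁻¹ ≤ 1 := inv_le_one_of_one_le₀ (by simp)
      have h6 : f m 0 t ≤ f m 0 ((⌊t * ((m + 1 : ℕ) : ℝ)⌋₊ : ℝ) / (m + 1 : ℕ)) :=
        (hf m).antitoneOn 0 ((half_pos ht).trans h2) ht
          ((div_le_iff₀ (hM0 m)).2 (Nat.floor_le (mul_pos ht (hM0 m)).le))
      have h7 := (abs_le.1 h3).2
      linarith
    have : BddAbove (range fun m => f m 0 t) :=
      (Filter.isBoundedUnder_of_eventually_le hev).bddAbove_range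
    obtain ⟨C, hC⟩ := this
    exact ⟨C, fun m => hC (mem_range_self m)⟩
  obtain ⟨φ, hφ, G, hG, hlim⟩ := exists_subseq_tendsto_cmFamily hf hbdd
  have hBlim : ∀ s > 0, Tendsto (fun m => B (φ m) ⌊s * ((φ m + 1 : ℕ) : ℝ)⌋₊) atTop (𝓝 (G 0 s)) := by
    intro s hs
    have h1 : Tendsto (fun m => f (φ m) 0 ((⌊s * ((φ m + 1 : ℕ) : ℝ)⌋₊ : ℝ) / (φ m + 1 : ℕ))) atTop
        (𝓝 (G 0 s)) :=
      tendsto_comp_of_antitoneOn hs (fun m => (hf (φ m)).antitoneOn 0)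
        ((hG.continuousOn 0).continuousAt (Ioi_mem_nhds hs)) hlim
        ((hgrid s hs).comp hφ.tendsto_atTop)
    have h2 : Tendsto (fun m => f (φ m) 0 ((⌊s * ((φ m + 1 : ℕ) : ℝ)⌋₊ : ℝ) / (φ m + 1 : ℕ)) -
        B (φ m) ⌊s * ((φ m + 1 : ℕ) : ℝ)⌋₊) atTop (𝓝 0) := by
      refine squeeze_zero_norm' ?_
        ((tendsto_inv_atTop_zero.comp hMt).comp hφ.tendsto_atTop)
      filter_upwards [hφ.tendsto_atTop.eventually (hrange s hs)] with m hm
      exact hfB (φ m) _ hm.1 hm.2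
    simpa using h1.sub h2
  obtain ⟨b, hb, hint, hsol⟩ := exists_solution_of_discrete hmono hcont hpos
    (M := fun m => ((φ m + 1 : ℕ) : ℝ)) (B := fun m => B (φ m)) (F := G 0)
    (fun m => hM0 (φ m)) (hMt.comp hφ.tendsto_atTop) (fun m => (hB (φ m)).nonneg)
    (fun m => (hB (φ m)).antitone) (fun m => heq (φ m)) (fun s hs => hG.nonneg 0 hs)
    (hG.continuousOn 0) hBlim
  exact ⟨b, G, hb, hG, hint, hsol⟩

end Bernstein

section Uniqueness

theorem eq_zero_of_integral_sub_mul_eq {D : ℝ → ℝ} {c : ℝ} (hD : ContinuousOn D (Ioi 0))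
    (hint : ∀ t, IntegrableOn D (Ioc 0 t)) (h : ∀ t > 0, ∫ s in (0 : ℝ)..t, (t - s) * D s = c * t) :
    c = 0 ∧ ∀ t > 0, D t = 0 := by
  have hi : ∀ t > 0, IntervalIntegrable D volume 0 t := fun t ht =>
    (intervalIntegrable_iff_integrableOn_Ioc_of_le ht.le).2 (hint t)
  have hi' : ∀ t > 0, IntervalIntegrable (fun s => s * D s) volume 0 t := fun t ht =>
    (hi t ht).continuousOn_mul continuousOn_id
  have hD' : ContinuousOn (fun s => s * D s) (Ioi 0) := continuousOn_id.mul hD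
  have hder : ∀ {f : ℝ → ℝ}, ContinuousOn f (Ioi 0) → (∀ t > 0, IntervalIntegrable f volume 0 t) →
      ∀ t > 0, HasDerivAt (fun t => ∫ s in (0 : ℝ)..t, f s) (f t) t := fun hf hfi t ht =>
    intervalIntegral.integral_hasDerivAt_right (hfi t ht)
      (hf.stronglyMeasurableAtFilter isOpen_Ioi t ht) (hf.continuousAt (Ioi_mem_nhds ht))
  have hP : ∀ t > 0, ∫ s in (0 : ℝ)..t, D s = c := by
    intro t ht
    have h1 : HasDerivAt (fun t => t * (∫ s in (0 : ℝ)..t, D s) - ∫ s in (0 : ℝ)..t, s * D s)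
        (1 * (∫ s in (0 : ℝ)..t, D s) + t * D t - t * D t) t :=
      ((hasDerivAt_id' t).mul (hder hD hi t ht)).sub (hder hD' hi' t ht)
    have h2 : HasDerivAt (fun t : ℝ => c * t) (c * 1) t := (hasDerivAt_id' t).const_mul c
    have h3 : (fun t => t * (∫ s in (0 : ℝ)..t, D s) - ∫ s in (0 : ℝ)..t, s * D s) =ᶠ[𝓝 t]
        fun t => c * t := by
      filter_upwards [Ioi_mem_nhds ht] with r hr
      rw [← h r hr, ← intervalIntegral.integral_const_mul,
        ← intervalIntegral.integral_sub ((hi r hr).const_mul r) (hi' r hr)]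
      refine intervalIntegral.integral_congr fun s _ => ?_
      ring
    have h4 := h1.unique (h2.congr_of_eventuallyEq h3)
    linarith
  have hzero : ∀ t > 0, D t = 0 := by
    intro t ht
    refine (hder hD hi t ht).unique ((hasDerivAt_const t c).congr_of_eventuallyEq ?_)
    filter_upwards [Ioi_mem_nhds ht] with r hr using hP r hr
  refine ⟨?_, hzero⟩
  rw [← hP 1 one_pos, intervalIntegral.integral_of_le zero_le_one,
    setIntegral_congr_fun measurableSet_Ioc fun s hs => hzero s hs.1]
  simp

variable {κ : ℝ → ℝ}

theorem integral_mul_indicator_eq {F : ℝ → ℝ} {b r t : ℝ}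
    (hsol : ∀ t > 0, b * κ t + ∫ s in (0 : ℝ)..t, κ s * F (t - s) = t) (hr : 0 < r) (hrt : r ≤ t) :
    ∫ u in Ioo 0 t, F u * (Ioi 0).indicator κ (r - u) = r - b * κ r := by
  have h1 : ∀ u, F u * (Ioi 0).indicator κ (r - u) =
      (Iio r).indicator (fun u => κ (r - u) * F u) u := by
    intro u
    by_cases hu : u < r
    · rw [indicator_of_mem (show r - u ∈ Ioi 0 from sub_pos.2 hu),
        indicator_of_mem (show u ∈ Iio r from hu), mul_comm]
    · rw [indicator_of_notMem (show r - u ∉ Ioi 0 from fun h => hu (sub_pos.1 h)),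
        indicator_of_notMem (show u ∉ Iio r from hu), mul_zero]
  have h2 : Ioo 0 t ∩ Iio r = Ioo 0 r := by
    rw [Ioo_inter_Iio, min_eq_right hrt]
  have hflip := intervalIntegral.integral_comp_sub_left (a := 0) (b := r)
    (fun s => κ s * F (r - s)) r
  simp only [sub_sub_cancel, sub_self, sub_zero] at hflip
  simp_rw [h1]
  rw [setIntegral_indicator measurableSet_Iio, h2, ← integral_Ioc_eq_integral_Ioo,
    ← intervalIntegral.integral_of_le hr.le, hflip]
  linarith [hsol r hr]

variable {F₁ F₂ : ℝ → ℝ} {b₁ b₂ : ℝ}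

theorem integral_mul_sub_eq (hmono : MonotoneOn κ (Ioi 0)) (hnn : ∀ t > 0, 0 ≤ κ t)
    (hF₁ : ∀ t, IntegrableOn F₁ (Ioc 0 t)) (hF₂ : ∀ t, IntegrableOn F₂ (Ioc 0 t))
    (h₁ : ∀ t > 0, b₁ * κ t + ∫ s in (0 : ℝ)..t, κ s * F₁ (t - s) = t)
    (h₂ : ∀ t > 0, b₂ * κ t + ∫ s in (0 : ℝ)..t, κ s * F₂ (t - s) = t) {t : ℝ} (ht : 0 < t) :
    (∫ s in Ioo 0 t, F₁ s * (t - s)) - b₂ * t = (∫ s in Ioo 0 t, F₂ s * (t - s)) - b₁ * t := by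
  set K := (Ioi (0 : ℝ)).indicator κ with hK
  have hK0 : ∀ r, 0 ≤ K r := fun r => indicator_nonneg (fun r hr => hnn r hr) r
  have hKmono : Monotone K := by
    intro x y hxy
    by_cases hx : x ∈ Ioi (0 : ℝ)
    · have hy : y ∈ Ioi (0 : ℝ) := lt_of_lt_of_le hx hxy
      rw [hK, indicator_of_mem hx, indicator_of_mem hy]
      exact hmono hx hy hxy
    · rw [hK, indicator_of_notMem hx]
      exact hK0 y
  have hF₁' : IntegrableOn F₁ (Ioo 0 t) := (hF₁ t).mono_set Ioo_subset_Ioc_self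
  have hF₂' : IntegrableOn F₂ (Ioo 0 t) := (hF₂ t).mono_set Ioo_subset_Ioc_self
  have hb : ∀ {F : ℝ → ℝ}, IntegrableOn F (Ioo 0 t) →
      IntegrableOn (fun s => F s * K (t - s)) (Ioo 0 t) := fun {F} hF => by
    refine hF.mul_bdd (c := K t)
      (hKmono.measurable.comp (measurable_const.sub measurable_id)).aestronglyMeasurable ?_
    refine (ae_restrict_iff' measurableSet_Ioo).2 (Eventually.of_forall fun s hs => ?_)
    rw [Real.norm_of_nonneg (hK0 _)]
    exact hKmono (by simpa using hs.1.le)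
  have hint : Integrable (Function.uncurry fun s u => F₁ s * F₂ u * K (t - s - u))
      ((volume.restrict (Ioo 0 t)).prod (volume.restrict (Ioo 0 t))) := by
    refine (Integrable.mul_prod hF₁' hF₂').mul_bdd (c := K t)
      (hKmono.measurable.comp
        ((measurable_const.sub measurable_fst).sub measurable_snd)).aestronglyMeasurable ?_
    rw [Measure.prod_restrict]
    refine (ae_restrict_iff' (measurableSet_Ioo.prod measurableSet_Ioo)).2
      (Eventually.of_forall fun z hz => ?_)
    rw [Real.norm_of_nonneg (hK0 _)]
    refine hKmono ?_
    have h1 := hz.1.1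
    have h2 := hz.2.1
    linarith
  have hswap := integral_integral_swap hint
  have hside : ∀ {F G : ℝ → ℝ} {b c : ℝ}, IntegrableOn F (Ioo 0 t) →
      (∀ t > 0, b * κ t + ∫ s in (0 : ℝ)..t, κ s * F (t - s) = t) →
      (∀ t > 0, c * κ t + ∫ s in (0 : ℝ)..t, κ s * G (t - s) = t) →
      ∫ s in Ioo 0 t, ∫ u in Ioo 0 t, F s * G u * K (t - s - u) =
        (∫ s in Ioo 0 t, F s * (t - s)) - c * (t - b * κ t) := by
    intro F G b c hF hFs hGs
    rw [← integral_mul_indicator_eq hFs ht le_rfl, ← integral_const_mul, ← integral_sub _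
      ((hb hF).const_mul c)]
    · refine setIntegral_congr_fun measurableSet_Ioo fun s hs => ?_
      have hs' : 0 < t - s := sub_pos.2 hs.2
      simp_rw [mul_assoc]
      rw [integral_const_mul, integral_mul_indicator_eq hGs hs' (by linarith [hs.1]),
        hK, indicator_of_mem (show t - s ∈ Ioi 0 from hs')]
      ring
    · refine hF.mul_bdd (c := t) (by fun_prop) ?_
      refine (ae_restrict_iff' measurableSet_Ioo).2 (Eventually.of_forall fun s hs => ?_)
      rw [Real.norm_of_nonneg (sub_pos.2 hs.2).le]
      linarith [hs.1]
  rw [hside hF₁' h₁ h₂] at hswap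
  have hcomm : ∀ u s, F₁ s * F₂ u * K (t - s - u) = F₂ u * F₁ s * K (t - u - s) := fun u s => by
    rw [mul_comm (F₁ s), sub_right_comm]
  simp_rw [hcomm] at hswap
  rw [hside hF₂' h₂ h₁] at hswap
  linarith

theorem conv_solution_unique (hmono : MonotoneOn κ (Ioi 0)) (hnn : ∀ t > 0, 0 ≤ κ t)
    (hc₁ : ContinuousOn F₁ (Ioi 0)) (hc₂ : ContinuousOn F₂ (Ioi 0))
    (hF₁ : IntegrableOn F₁ (Ioc 0 1)) (hF₂ : IntegrableOn F₂ (Ioc 0 1))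
    (h₁ : ∀ t > 0, b₁ * κ t + ∫ s in (0 : ℝ)..t, κ s * F₁ (t - s) = t)
    (h₂ : ∀ t > 0, b₂ * κ t + ∫ s in (0 : ℝ)..t, κ s * F₂ (t - s) = t) :
    b₁ = b₂ ∧ ∀ t > 0, F₁ t = F₂ t := by
  have hi₁ := integrableOn_Ioc_of_integrableOn_Ioc_one hc₁ hF₁
  have hi₂ := integrableOn_Ioc_of_integrableOn_Ioc_one hc₂ hF₂
  have key := eq_zero_of_integral_sub_mul_eq (D := fun s => F₁ s - F₂ s) (c := b₂ - b₁)
    (hc₁.sub hc₂) (fun t => (hi₁ t).sub (hi₂ t)) fun t ht => by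
      have h := integral_mul_sub_eq hmono hnn hi₁ hi₂ h₁ h₂ ht
      have hint : ∀ {F : ℝ → ℝ}, IntegrableOn F (Ioc 0 t) →
          IntervalIntegrable (fun s => F s * (t - s)) volume 0 t := fun hF =>
        ((intervalIntegrable_iff_integrableOn_Ioc_of_le ht.le).2 hF).mul_continuousOn
          (by fun_prop)
      rw [← integral_Ioc_eq_integral_Ioo, ← integral_Ioc_eq_integral_Ioo,
        ← intervalIntegral.integral_of_le ht.le, ← intervalIntegral.integral_of_le ht.le] at h
      have h' := intervalIntegral.integral_sub (hint (hi₁ t)) (hint (hi₂ t))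
      have h'' : ∫ s in (0 : ℝ)..t, (t - s) * (F₁ s - F₂ s) =
          ∫ s in (0 : ℝ)..t, (F₁ s * (t - s) - F₂ s * (t - s)) :=
        intervalIntegral.integral_congr fun s _ => by ring
      rw [h'', h']
      linarith
  exact ⟨by linarith [key.1], fun t ht => sub_eq_zero.1 (key.2 t ht)⟩

end Uniqueness

/-- If `κ` is a not-identically-zero Bernstein function, then there exist
`b ≥ 0` and an LICM function `F` such that `λ(t) = b·δ(t) + F(t)` solves `(κ∗λ)(t) = t`,
i.e. `b·κ(t) + (κ∗F)(t) = t` for all `t > 0`; moreover this solution is unique. -/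
theorem bernstein_conv_eq_t_unique_solution (κ : ℝ → ℝ) (hκ : ScalarBernstein κ)
    (hnz : ∃ t ∈ Set.Ioi (0:ℝ), κ t ≠ 0) :
    ∃ (b : ℝ) (F : ℝ → ℝ), 0 ≤ b ∧ ScalarLICM F ∧
      (∀ t ∈ Set.Ioi (0:ℝ), b * κ t + (∫ s in (0:ℝ)..t, κ s * F (t - s)) = t) ∧
      ∀ (b' : ℝ) (F' : ℝ → ℝ), 0 ≤ b' → ScalarLICM F' →
        (∀ t ∈ Set.Ioi (0:ℝ), b' * κ t + (∫ s in (0:ℝ)..t, κ s * F' (t - s)) = t) →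
        b' = b ∧ ∀ t ∈ Set.Ioi (0:ℝ), F' t = F t := by
  have hg := hκ.2.2.cmFamily
  have hd : ∀ t > 0, HasDerivAt κ ((-1) ^ 0 * iteratedDeriv 0 (deriv κ) t) t := fun t ht => by
    simpa using (hκ.2.1.differentiableAt (Ioi_mem_nhds ht)).hasDerivAt
  have hmono := monotoneOn_of_cmFamily_deriv hg hd
  obtain ⟨b, G, hb, hG, hint, hsol⟩ :=
    exists_cmFamily_solution hg hd (pos_of_cmFamily_deriv hg hd hκ.1 hnz)
  refine ⟨b, G 0, hb, ⟨hG.scalarCM, hint⟩, hsol, fun b' F' _ hF' hsol' => ?_⟩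
  exact conv_solution_unique hmono hκ.1 hF'.1.1.continuousOn (hG.continuousOn 0) hF'.2 hint
    hsol' hsol
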